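/- Soundararajan's omega result for the circle problem: limsup_{x→∞} |P(x)| / ( x^{1/4} (log x)^{1/4} (log log x)^{(3/4)(2^{1/3}−1)} (log log log x)^{−5/8} ) > 0. -/

import Mathlib

open Real Filter

/-- The number of integer lattice points in the closed origin-centered disc of radius `√x`. -/
noncomputable def latticeA (x : ℝ) : ℕ :=
  {p : ℤ × ℤ | (p.1 : ℝ) ^ 2 + (p.2 : ℝ) ^ 2 ≤ x}.ncard

/-- The lattice point discrepancy of the circle. -/
noncomputable def latticeP (x : ℝ) : ℝ := (latticeA x : ℝ) - Real.pi * x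

section

open MeasureTheory Set

/-- The squared Euclidean norm of a lattice point. -/
noncomputable def nsq (v : ℤ × ℤ) : ℝ := (v.1 : ℝ) ^ 2 + (v.2 : ℝ) ^ 2

lemma nsq_nonneg (v : ℤ × ℤ) : 0 ≤ nsq v := by unfold nsq; positivity

lemma nsq_zero : nsq 0 = 0 := by simp [nsq]

lemma one_le_nsq {v : ℤ × ℤ} (hv : v ≠ 0) : 1 ≤ nsq v := by
  have h : (1 : ℤ) ≤ v.1 ^ 2 + v.2 ^ 2 := by
    by_contra! h
    have h1 : v.1 = 0 := by nlinarith [sq_nonneg v.1, sq_nonneg v.2]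
    have h2 : v.2 = 0 := by nlinarith [sq_nonneg v.1, sq_nonneg v.2]
    exact hv (Prod.ext h1 h2)
  unfold nsq
  exact_mod_cast h

lemma summable_cexp_int_sq {s : ℂ} (hs : 0 < s.re) :
    Summable fun n : ℤ ↦ Complex.exp (-π * s * (n : ℂ) ^ 2) := by
  have h := (summable_jacobiTheta₂_term_iff 0 (Complex.I * s)).2 (by simpa using hs)
  refine h.congr fun n ↦ ?_
  rw [jacobiTheta₂_term]
  congr 1
  linear_combination (π * s * (n : ℂ) ^ 2) * Complex.I_sq

lemma cexp_nsq (s : ℂ) (v : ℤ × ℤ) :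
    Complex.exp (-π * s * nsq v) =
      Complex.exp (-π * s * (v.1 : ℂ) ^ 2) * Complex.exp (-π * s * (v.2 : ℂ) ^ 2) := by
  rw [← Complex.exp_add, nsq]
  push_cast
  ring_nf

lemma tsum_cexp_nsq_eq_sq {s : ℂ} (hs : 0 < s.re) :
    ∑' v : ℤ × ℤ, Complex.exp (-π * s * nsq v) =
      (∑' n : ℤ, Complex.exp (-π * s * (n : ℂ) ^ 2)) ^ 2 := by
  rw [sq, tsum_mul_tsum_of_summable_norm (summable_cexp_int_sq hs).norm
    (summable_cexp_int_sq hs).norm]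
  exact tsum_congr fun v ↦ cexp_nsq s v

lemma inv_re_pos {s : ℂ} (hs : 0 < s.re) : 0 < (s⁻¹).re := by
  have : s ≠ 0 := fun h ↦ by simp [h] at hs
  rw [Complex.inv_re]
  exact div_pos hs (Complex.normSq_pos.2 this)

/-- Poisson summation for two-dimensional Gaussians with a complex parameter. -/
lemma tsum_cexp_nsq_inversion {s : ℂ} (hs : 0 < s.re) :
    ∑' v : ℤ × ℤ, Complex.exp (-π * s * nsq v) =
      s⁻¹ * ∑' v : ℤ × ℤ, Complex.exp (-π * s⁻¹ * nsq v) := by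
  rw [tsum_cexp_nsq_eq_sq hs, tsum_cexp_nsq_eq_sq (inv_re_pos hs),
    Complex.tsum_exp_neg_mul_int_sq hs, mul_pow, div_pow, ← Complex.cpow_nat_mul]
  simp [div_eq_mul_inv]

lemma summable_nsq_rpow : Summable fun v : ℤ × ℤ ↦ nsq v ^ (-(3 / 2) : ℝ) := by
  have h := EisensteinSeries.summable_one_div_norm_rpow (k := 3) (by norm_num)
  rw [← (finTwoArrowEquiv ℤ).symm.summable_iff] at h
  refine h.of_nonneg_of_le (fun v ↦ rpow_nonneg (nsq_nonneg v) _) fun v ↦ ?_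
  rcases eq_or_ne v 0 with rfl | hv
  · rw [nsq_zero, zero_rpow (by norm_num)]
    exact rpow_nonneg (norm_nonneg _) _
  set x := (finTwoArrowEquiv ℤ).symm v
  have hx : x ≠ 0 := fun h0 ↦ hv <| by
    have : v = finTwoArrowEquiv ℤ x := by simp [x]
    rw [this, h0]; rfl
  have hx0 : x 0 = v.1 := by simp [x]
  have hx1 : x 1 = v.2 := by simp [x]
  have hpos : 0 < ‖x‖ := norm_pos_iff.2 hx
  have hle : ‖x‖ ≤ √(nsq v) := by
    refine (pi_norm_le_iff_of_nonneg (sqrt_nonneg _)).2 fun i ↦ ?_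
    refine Real.le_sqrt_of_sq_le ?_
    rw [Int.norm_eq_abs, sq_abs]
    fin_cases i
    · simp only [Fin.zero_eta, hx0, nsq]; nlinarith [sq_nonneg (v.2 : ℝ)]
    · simp only [Fin.mk_one, hx1, nsq]; nlinarith [sq_nonneg (v.1 : ℝ)]
  change nsq v ^ (-(3 / 2) : ℝ) ≤ ‖x‖ ^ (-3 : ℝ)
  calc nsq v ^ (-(3 / 2) : ℝ) = √(nsq v) ^ (-3 : ℝ) := by
        rw [sqrt_eq_rpow, ← rpow_mul (nsq_nonneg v)]; norm_num
    _ ≤ ‖x‖ ^ (-3 : ℝ) := rpow_le_rpow_of_nonpos hpos hle (by norm_num)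

lemma summable_exp_neg_sqrt_nsq {a : ℝ} (ha : 0 < a) :
    Summable fun v : ℤ × ℤ ↦ rexp (-a * √(nsq v)) := by
  have hb : ∀ t : ℝ, 0 < t → rexp (-a * t) ≤ 6 / a ^ 3 * t ^ (-3 : ℝ) := fun t ht ↦ by
    have h := Real.pow_div_factorial_le_exp (x := a * t) (by positivity) 3
    have h3 : t ^ (-3 : ℝ) = (t ^ 3)⁻¹ := by
      rw [rpow_neg ht.le]; norm_cast
    rw [h3, neg_mul, Real.exp_neg, ← div_eq_mul_inv, inv_le_comm₀ (exp_pos _) (by positivity)]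
    refine le_trans (le_of_eq ?_) h
    have : (Nat.factorial 3 : ℝ) = 6 := by norm_num [Nat.factorial]
    rw [this]; field_simp
  rw [← (Set.finite_singleton (0 : ℤ × ℤ)).summable_compl_iff]
  refine ((summable_nsq_rpow.mul_left (6 / a ^ 3)).subtype _).of_nonneg_of_le
    (fun v ↦ (exp_pos _).le) fun v ↦ ?_
  have hv : 0 < nsq v := zero_lt_one.trans_le (one_le_nsq v.2)
  refine (hb _ (sqrt_pos.2 hv)).trans (le_of_eq ?_)
  simp only [Function.comp_apply]
  rw [sqrt_eq_rpow, ← rpow_mul hv.le]; norm_num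

lemma hasDerivAt_sub_div {r y : ℝ} (hy : 0 < y) :
    HasDerivAt (fun y : ℝ ↦ y - r / y) (1 + r / y ^ 2) y := by
  convert! (hasDerivAt_id y).sub ((hasDerivAt_inv hy.ne').const_mul r) using 1
  ring

lemma injOn_sub_div {r : ℝ} (hr : 0 < r) : InjOn (fun y : ℝ ↦ y - r / y) (Ioi 0) := by
  refine StrictMonoOn.injOn fun a ha b hb hab ↦ ?_
  have h : r / b < r / a := div_lt_div_of_pos_left hr ha hab
  change a - r / a < b - r / b
  linarith

lemma image_sub_div {r : ℝ} (hr : 0 < r) : (fun y : ℝ ↦ y - r / y) '' Ioi 0 = univ := by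
  refine eq_univ_of_forall fun w ↦ ⟨(w + √(w ^ 2 + 4 * r)) / 2, ?_, ?_⟩
  all_goals
    have h1 : |w| < √(w ^ 2 + 4 * r) := by
      rw [← sqrt_sq_eq_abs]; exact sqrt_lt_sqrt (sq_nonneg _) (by linarith)
    have h2 : 0 < w + √(w ^ 2 + 4 * r) := by linarith [neg_abs_le w]
  · exact half_pos h2
  · have h3 := sq_sqrt (show 0 ≤ w ^ 2 + 4 * r by positivity)
    set q := √(w ^ 2 + 4 * r)
    simp only
    field_simp
    linarith

lemma image_div {r : ℝ} (hr : 0 < r) : (fun y : ℝ ↦ r / y) '' Ioi 0 = Ioi 0 := by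
  refine Subset.antisymm (fun w ↦ ?_) fun w hw ↦ ⟨r / w, div_pos hr hw, ?_⟩
  · rintro ⟨y, hy, rfl⟩
    exact div_pos hr hy
  · simp only
    exact div_div_cancel₀ hr.ne'

lemma integrable_cexp_neg_mul_sq' {z : ℂ} (hz : 0 < z.re) :
    Integrable fun y : ℝ ↦ Complex.exp (-(π * z) * (y : ℂ) ^ 2) :=
  integrable_cexp_neg_mul_sq (by rw [Complex.re_ofReal_mul]; positivity)

lemma cauchy_schlomilch {z : ℂ} (hz : 0 < z.re) {r : ℝ} (hr : 0 < r) :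
    IntegrableOn (fun y : ℝ ↦ Complex.exp (-(π * z) * ((y - r / y : ℝ) : ℂ) ^ 2)) (Ioi 0) ∧
    ∫ y in Ioi (0 : ℝ), Complex.exp (-(π * z) * ((y - r / y : ℝ) : ℂ) ^ 2) =
      z⁻¹ ^ (1 / 2 : ℂ) / 2 := by
  set G : ℝ → ℂ := fun w ↦ Complex.exp (-(π * z) * (w : ℂ) ^ 2) with hG
  set g : ℝ → ℂ := fun y ↦ G (y - r / y) with hg
  have hd : ∀ y ∈ Ioi (0 : ℝ),
      HasDerivWithinAt (fun y : ℝ ↦ y - r / y) (1 + r / y ^ 2) (Ioi 0) y :=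
    fun y hy ↦ (hasDerivAt_sub_div hy).hasDerivWithinAt
  have habs : ∀ y : ℝ, |1 + r / y ^ 2| = 1 + r / y ^ 2 := fun y ↦ abs_of_nonneg (by positivity)
  have hint : IntegrableOn (fun y ↦ (1 + r / y ^ 2) • g y) (Ioi 0) := by
    have h := (integrableOn_image_iff_integrableOn_abs_deriv_smul measurableSet_Ioi hd
      (injOn_sub_div hr) G).1 (integrable_cexp_neg_mul_sq' hz).integrableOn
    simpa only [habs] using h
  have hgm : AEStronglyMeasurable g (volume.restrict (Ioi 0)) := by
    refine Measurable.aestronglyMeasurable ?_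
    fun_prop
  have hgi : IntegrableOn g (Ioi 0) := by
    refine Integrable.mono hint hgm (ae_of_all _ fun y ↦ ?_)
    rw [norm_smul, norm_eq_abs, habs]
    have : 0 ≤ r / y ^ 2 := by positivity
    nlinarith [norm_nonneg (g y)]
  have hgi2 : IntegrableOn (fun y ↦ (r / y ^ 2) • g y) (Ioi 0) := by
    refine (hint.sub hgi).congr (ae_of_all _ fun y ↦ ?_)
    simp [add_smul]
  have h1 : ∫ y in Ioi (0 : ℝ), (1 + r / y ^ 2) • g y = z⁻¹ ^ (1 / 2 : ℂ) := by
    have h := integral_image_eq_integral_abs_deriv_smul measurableSet_Ioi hd (injOn_sub_div hr) G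
    simp only [habs] at h
    rw [← h, image_sub_div hr, Measure.restrict_univ, hG,
      integral_gaussian_complex (by rw [Complex.re_ofReal_mul]; positivity)]
    congr 1
    have : (π : ℂ) ≠ 0 := by exact_mod_cast pi_ne_zero
    rw [div_mul_eq_div_div, div_self this, one_div]
  have h2 : ∫ y in Ioi (0 : ℝ), g y = ∫ y in Ioi (0 : ℝ), (r / y ^ 2) • g y := by
    have hd' : ∀ y ∈ Ioi (0 : ℝ),
        HasDerivWithinAt (fun y : ℝ ↦ r / y) (-(r / y ^ 2)) (Ioi 0) y := fun y hy ↦ by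
      convert! ((hasDerivAt_inv (ne_of_gt hy)).const_mul r).hasDerivWithinAt using 1
      ring
    have hinj : InjOn (fun y : ℝ ↦ r / y) (Ioi 0) := fun a ha b hb hab ↦ by
      simp only at hab
      have ha' : a ≠ 0 := ne_of_gt ha
      have hb' : b ≠ 0 := ne_of_gt hb
      field_simp at hab
      exact hab.symm
    have h := integral_image_eq_integral_abs_deriv_smul measurableSet_Ioi hd' hinj g
    rw [image_div hr] at h
    rw [h]
    refine setIntegral_congr_fun measurableSet_Ioi fun y hy ↦ ?_
    have hy' : y ≠ 0 := ne_of_gt hy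
    simp only [abs_neg, hg, hG]
    rw [abs_of_nonneg (by positivity), div_div_cancel₀ hr.ne', ← neg_sub y]
    push_cast
    rw [neg_sq]
  refine ⟨hgi, ?_⟩
  change ∫ y in Ioi (0 : ℝ), g y = _
  simp only [add_smul, one_smul] at h1
  rw [integral_add hgi hgi2, ← h2] at h1
  rw [← h1]
  ring

lemma integral_subordination {z : ℂ} (hz : 0 < z.re) {r : ℝ} (hr : 0 ≤ r) :
    IntegrableOn (fun y : ℝ ↦ Complex.exp (-(π * z) * ((y ^ 2 + r ^ 2 / y ^ 2 : ℝ) : ℂ))) (Ioi 0) ∧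
    ∫ y in Ioi (0 : ℝ), Complex.exp (-(π * z) * ((y ^ 2 + r ^ 2 / y ^ 2 : ℝ) : ℂ)) =
      Complex.exp (-(2 * π * z * r)) * (z⁻¹ ^ (1 / 2 : ℂ) / 2) := by
  rcases hr.eq_or_lt with rfl | hr
  · simp only [ne_eq, OfNat.ofNat_ne_zero, not_false_eq_true, zero_pow, zero_div, add_zero,
      Complex.ofReal_pow, Complex.ofReal_zero, mul_zero, neg_zero, Complex.exp_zero, one_mul]
    refine ⟨(integrable_cexp_neg_mul_sq' hz).integrableOn, ?_⟩
    rw [integral_gaussian_complex_Ioi (by rw [Complex.re_ofReal_mul]; positivity)]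
    congr 2
    have : (π : ℂ) ≠ 0 := by exact_mod_cast pi_ne_zero
    rw [div_mul_eq_div_div, div_self this, one_div]
  · obtain ⟨h1, h2⟩ := cauchy_schlomilch hz hr
    have hE : ∀ y ∈ Ioi (0 : ℝ), Complex.exp (-(2 * π * z * r)) *
        Complex.exp (-(π * z) * ((y - r / y : ℝ) : ℂ) ^ 2) =
        Complex.exp (-(π * z) * ((y ^ 2 + r ^ 2 / y ^ 2 : ℝ) : ℂ)) := fun y hy ↦ by
      rw [← Complex.exp_add]
      congr 1
      have hy' : (y : ℂ) ≠ 0 := by exact_mod_cast ne_of_gt hy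
      push_cast
      field_simp
      ring
    refine ⟨IntegrableOn.congr_fun (Integrable.const_mul h1 _) hE measurableSet_Ioi, ?_⟩
    rw [← setIntegral_congr_fun measurableSet_Ioi hE, integral_const_mul, h2]

lemma integral_sq_mul_cexp {w : ℂ} (hw : 0 < w.re) :
    IntegrableOn (fun y : ℝ ↦ (y : ℂ) ^ 2 * Complex.exp (-(π * w) * (y : ℂ) ^ 2)) (Ioi 0) ∧
    ∫ y in Ioi (0 : ℝ), (y : ℂ) ^ 2 * Complex.exp (-(π * w) * (y : ℂ) ^ 2) =
      (2 * π * w)⁻¹ * (w⁻¹ ^ (1 / 2 : ℂ) / 2) := by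
  have hw0 : w ≠ 0 := fun h ↦ by simp [h] at hw
  have hpi : (π : ℂ) ≠ 0 := by exact_mod_cast pi_ne_zero
  have hre : ∀ y : ℝ, ‖Complex.exp (-(π * w) * (y : ℂ) ^ 2)‖ = rexp (-(π * w.re) * y ^ 2) :=
    fun y ↦ by
      rw [Complex.norm_exp]
      congr 1
      rw [← Complex.ofReal_pow, Complex.re_mul_ofReal, Complex.neg_re, Complex.re_ofReal_mul]
  have hpos : 0 < π * w.re := by positivity
  have hint : IntegrableOn (fun y : ℝ ↦ (y : ℂ) ^ 2 * Complex.exp (-(π * w) * (y : ℂ) ^ 2))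
      (Ioi 0) := by
    have h := integrableOn_rpow_mul_exp_neg_mul_sq hpos (s := 2) (by norm_num)
    refine Integrable.mono h (Measurable.aestronglyMeasurable (by fun_prop))
      (ae_of_all _ fun y ↦ ?_)
    rw [norm_mul, hre, norm_mul, rpow_two, norm_of_nonneg (exp_pos _).le]
    simp
  refine ⟨hint, ?_⟩
  have hd : ∀ y ∈ Ioi (0 : ℝ), HasDerivAt
      (fun y : ℝ ↦ (y : ℂ) * Complex.exp (-(π * w) * (y : ℂ) ^ 2))
      (Complex.exp (-(π * w) * (y : ℂ) ^ 2) -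
        (2 * π * w) * ((y : ℂ) ^ 2 * Complex.exp (-(π * w) * (y : ℂ) ^ 2))) y := fun y _ ↦ by
    have h1 : HasDerivAt (fun y : ℂ ↦ y * Complex.exp (-(π * w) * y ^ 2))
        (1 * Complex.exp (-(π * w) * (y : ℂ) ^ 2) +
          y * (Complex.exp (-(π * w) * (y : ℂ) ^ 2) * (-(π * w) * (2 * (y : ℂ))))) (y : ℂ) := by
      have := ((hasDerivAt_pow 2 (y : ℂ)).const_mul (-(π * w))).cexp
      convert! (hasDerivAt_id (y : ℂ)).mul this using 1
      simp
    convert! h1.comp_ofReal using 1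
    ring
  have hexp := (integrable_cexp_neg_mul_sq' hw).integrableOn (s := Ioi 0)
  have hlim : Tendsto (fun y : ℝ ↦ (y : ℂ) * Complex.exp (-(π * w) * (y : ℂ) ^ 2)) atTop
      (nhds 0) := by
    have h1 := (rpow_mul_exp_neg_mul_sq_isLittleO_exp_neg hpos 1).trans_tendsto
      (Real.tendsto_exp_neg_atTop_nhds_zero.comp
        (tendsto_id.const_mul_atTop (show (0 : ℝ) < 1 / 2 by norm_num)) |>.congr fun y ↦ by
          simp)
    rw [tendsto_zero_iff_norm_tendsto_zero] at h1 ⊢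
    refine h1.congr fun y ↦ ?_
    rw [norm_mul, norm_mul, hre, rpow_one, norm_of_nonneg (exp_pos _).le]
    simp
  have h := integral_Ioi_of_hasDerivAt_of_tendsto (Continuous.continuousWithinAt (by fun_prop))
    hd (Integrable.sub hexp (Integrable.const_mul hint _)) hlim
  rw [integral_sub hexp (Integrable.const_mul hint _), integral_const_mul,
    integral_gaussian_complex_Ioi (by rw [Complex.re_ofReal_mul]; positivity)] at h
  simp only [Complex.ofReal_zero, zero_mul, sub_zero] at h
  have hw' : (π : ℂ) / (π * w) = w⁻¹ := by field_simp
  rw [hw', sub_eq_zero] at h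
  rw [h, inv_mul_cancel_left₀ (by simp [hw0, hpi])]

/-- The Laplace transform factor `(1 + a / z²)^(-1/2)`, in a form holomorphic for `0 < Re z`. -/
noncomputable def lker (a : ℝ) (z : ℂ) : ℂ := z ^ (1 / 2 : ℂ) * (z + a / z)⁻¹ ^ (1 / 2 : ℂ)

lemma re_add_div_pos {a : ℝ} (ha : 0 ≤ a) {z : ℂ} (hz : 0 < z.re) : 0 < (z + a / z).re := by
  rw [Complex.add_re, div_eq_mul_inv, Complex.re_ofReal_mul]
  have := inv_re_pos hz
  positivity

lemma add_div_ne_zero {a : ℝ} (ha : 0 ≤ a) {z : ℂ} (hz : 0 < z.re) : z + a / z ≠ 0 := fun h ↦ by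
  have := re_add_div_pos ha hz
  simp [h] at this

lemma ne_zero_of_re {z : ℂ} (hz : 0 < z.re) : z ≠ 0 := fun h ↦ by simp [h] at hz

lemma sq_add_eq {a : ℝ} {z : ℂ} (hz : 0 < z.re) : z ^ 2 + a = z * (z + a / z) := by
  have := ne_zero_of_re hz
  field_simp

lemma cpow_half_mul_self {z : ℂ} : z ^ (1 / 2 : ℂ) * z ^ (1 / 2 : ℂ) = z := by
  rw [← sq, ← Complex.cpow_nat_mul]; simp

lemma norm_sq_cpow_half (z : ℂ) : ‖z ^ (1 / 2 : ℂ)‖ ^ 2 = ‖z‖ := by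
  rw [← norm_pow, sq, cpow_half_mul_self]

lemma inv_cpow_half {z : ℂ} (hz : 0 < z.re) : z⁻¹ ^ (1 / 2 : ℂ) = (z ^ (1 / 2 : ℂ))⁻¹ := by
  refine Complex.inv_cpow _ _ fun h ↦ ?_
  have := Complex.arg_eq_pi_iff.1 h
  linarith [this.1]

lemma lker_zero {z : ℂ} (hz : 0 < z.re) : lker 0 z = 1 := by
  rw [lker, Complex.ofReal_zero, zero_div, add_zero, inv_cpow_half hz]
  refine mul_inv_cancel₀ fun h ↦ ne_zero_of_re hz ?_
  rw [← cpow_half_mul_self (z := z), h, zero_mul]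

lemma lker_sq (a : ℝ) {z : ℂ} (hz : 0 < z.re) : lker a z ^ 2 = z ^ 2 / (z ^ 2 + a) := by
  have := ne_zero_of_re hz
  rw [lker, mul_pow, sq, sq, cpow_half_mul_self, cpow_half_mul_self, sq_add_eq hz]
  field_simp

/-- Poisson summation for the radial exponential `v ↦ exp (-2πz|v|)` with a complex parameter. -/
lemma hasSum_lker {z : ℂ} (hz : 0 < z.re) :
    HasSum (fun v : ℤ × ℤ ↦ lker (nsq v) z / (2 * π * (z ^ 2 + nsq v)))
      (∑' v : ℤ × ℤ, Complex.exp (-(2 * π * z * √(nsq v)))) := by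
  have hz0 := ne_zero_of_re hz
  have hpi : (π : ℂ) ≠ 0 := by exact_mod_cast pi_ne_zero
  have hN : ∀ v : ℤ × ℤ, √(nsq v) ^ 2 = nsq v := fun v ↦ sq_sqrt (nsq_nonneg v)
  have hζ : (0 : ℝ) < ((z.re : ℂ)).re := by simpa using hz
  have hzh : z ^ (1 / 2 : ℂ) ≠ 0 := fun h ↦ hz0 <| by
    rw [← cpow_half_mul_self (z := z), h, zero_mul]
  set F : ℤ × ℤ → ℝ → ℂ := fun v y ↦
    Complex.exp (-(π * z) * ((y ^ 2 + √(nsq v) ^ 2 / y ^ 2 : ℝ) : ℂ)) with hF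
  set G : ℤ × ℤ → ℝ → ℂ := fun v y ↦
    (y : ℂ) ^ 2 * Complex.exp (-(π * (z + nsq v / z)) * (y : ℂ) ^ 2) with hG
  have hFn : ∀ v y, ‖F v y‖ = (Complex.exp (-(π * (z.re : ℂ)) *
      ((y ^ 2 + √(nsq v) ^ 2 / y ^ 2 : ℝ) : ℂ))).re := fun v y ↦ by
    rw [hF, Complex.norm_exp]
    rw [← Complex.ofReal_mul, ← Complex.ofReal_neg, ← Complex.ofReal_mul, Complex.exp_ofReal_re,
      Complex.re_mul_ofReal, Complex.neg_re, Complex.re_ofReal_mul]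
  have hFi : ∀ v, ∫ y in Ioi (0 : ℝ), ‖F v y‖ =
      rexp (-(2 * π * z.re) * √(nsq v)) * ((z.re : ℂ)⁻¹ ^ (1 / 2 : ℂ) / 2).re := fun v ↦ by
    obtain ⟨h1, h2⟩ := integral_subordination hζ (sqrt_nonneg (nsq v))
    simp_rw [hFn]
    have h3 := integral_re h1
    simp only [RCLike.re_eq_complex_re] at h3
    rw [h3, h2]
    have : Complex.exp (-(2 * π * (z.re : ℂ) * √(nsq v))) =
      (rexp (-(2 * π * z.re) * √(nsq v)) : ℂ) := by push_cast; ring_nf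
    rw [this, Complex.re_ofReal_mul]
  have hGn : ∀ v y, ‖G v y‖ = ((y : ℂ) ^ 2 *
      Complex.exp (-(π * ((z + nsq v / z).re : ℂ)) * (y : ℂ) ^ 2)).re := fun v y ↦ by
    rw [hG, norm_mul, Complex.norm_exp, ← Complex.ofReal_mul, ← Complex.ofReal_neg,
      ← Complex.ofReal_pow, ← Complex.ofReal_mul, ← Complex.ofReal_exp, ← Complex.ofReal_mul,
      Complex.ofReal_re, Complex.re_mul_ofReal, Complex.neg_re, Complex.re_ofReal_mul]
    simp
  have hGi : ∀ v, ∫ y in Ioi (0 : ℝ), ‖G v y‖ =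
      ((2 * π * (z + nsq v / z).re)⁻¹ * ((((z + nsq v / z).re)⁻¹) ^ (1 / 2 : ℝ) / 2)) := fun v ↦ by
    have hre := re_add_div_pos (nsq_nonneg v) hz
    obtain ⟨h1, h2⟩ := integral_sq_mul_cexp (w := ((z + nsq v / z).re : ℂ)) (by simpa using hre)
    simp_rw [hGn]
    have h3 := integral_re h1
    simp only [RCLike.re_eq_complex_re] at h3
    rw [h3, h2, ← Complex.ofReal_inv]
    have : (((z + nsq v / z).re)⁻¹ : ℂ) ^ (1 / 2 : ℂ) =
        ((((z + nsq v / z).re)⁻¹ ^ (1 / 2 : ℝ) : ℝ) : ℂ) := by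
      rw [Complex.ofReal_cpow (inv_nonneg.2 hre.le)]; norm_num
    rw [Complex.ofReal_inv, this]
    norm_cast
  have hF1 := hasSum_integral_of_summable_integral_norm (μ := volume.restrict (Ioi 0)) (F := F)
    (fun v ↦ (integral_subordination hz (sqrt_nonneg _)).1) (by
      simp_rw [hFi]
      exact (summable_exp_neg_sqrt_nsq (by positivity)).mul_right _)
  have hG1 := hasSum_integral_of_summable_integral_norm (μ := volume.restrict (Ioi 0)) (F := G)
    (fun v ↦ (integral_sq_mul_cexp (re_add_div_pos (nsq_nonneg v) hz)).1) (by
      simp_rw [hGi]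
      have hi := inv_re_pos hz
      rw [← (Set.finite_singleton (0 : ℤ × ℤ)).summable_compl_iff]
      refine ((summable_nsq_rpow.mul_left ((2 * π * (z⁻¹).re)⁻¹ *
        (((z⁻¹).re)⁻¹ ^ (1 / 2 : ℝ) / 2))).subtype _).of_nonneg_of_le (fun v ↦ ?_) fun v ↦ ?_
      · have := re_add_div_pos (nsq_nonneg v) hz
        simp only [Function.comp_apply]
        positivity
      · have hv : 0 < nsq v := zero_lt_one.trans_le (one_le_nsq v.2)
        have hle : (z⁻¹).re * nsq v ≤ (z + nsq v / z).re := by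
          rw [Complex.add_re, div_eq_mul_inv, Complex.re_ofReal_mul]
          linarith
        have hp : 0 < (z⁻¹).re * nsq v := by positivity
        have hw := re_add_div_pos (nsq_nonneg v) hz
        calc (2 * π * (z + nsq v / z).re)⁻¹ * ((((z + nsq v / z).re)⁻¹) ^ (1 / 2 : ℝ) / 2)
            ≤ (2 * π * ((z⁻¹).re * nsq v))⁻¹ * ((((z⁻¹).re * nsq v))⁻¹ ^ (1 / 2 : ℝ) / 2) := by
              gcongr
          _ = _ := by
              simp only [Function.comp_apply]
              have : nsq v ^ (-(3 / 2) : ℝ) = (nsq (v : ℤ × ℤ))⁻¹ * (nsq v)⁻¹ ^ (1 / 2 : ℝ) := by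
                rw [← rpow_neg_one (nsq v), ← rpow_mul hv.le, ← rpow_add hv]
                norm_num
              rw [this, mul_inv ((z⁻¹).re), mul_rpow (by positivity) (by positivity)]
              field_simp)
  have hint : ∫ y in Ioi (0 : ℝ), ∑' v, F v y = z⁻¹ * ∫ y in Ioi (0 : ℝ), ∑' v, G v y := by
    rw [← integral_const_mul]
    refine setIntegral_congr_fun measurableSet_Ioi fun y hy ↦ ?_
    have hy : 0 < y := hy
    have hy' : (y : ℂ) ≠ 0 := by exact_mod_cast hy.ne'
    have hs : 0 < (z / (y : ℂ) ^ 2).re := by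
      rw [← Complex.ofReal_pow, Complex.div_ofReal_re]; positivity
    have h := tsum_cexp_nsq_inversion hs
    have e1 : ∀ v, F v y = Complex.exp (-(π * z) * (y : ℂ) ^ 2) *
        Complex.exp (-π * (z / (y : ℂ) ^ 2) * nsq v) := fun v ↦ by
      rw [hF, ← Complex.exp_add]
      simp only [hN]
      congr 1
      push_cast
      field_simp
      ring
    have e2 : ∀ v, G v y = (y : ℂ) ^ 2 * Complex.exp (-(π * z) * (y : ℂ) ^ 2) *
        Complex.exp (-π * (z / (y : ℂ) ^ 2)⁻¹ * nsq v) := fun v ↦ by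
      rw [hG, mul_assoc, ← Complex.exp_add]
      simp only
      congr 2
      field_simp
      ring
    simp_rw [e1, e2]
    rw [tsum_mul_left, h, tsum_mul_left]
    field_simp
  rw [hint] at hF1
  have hF2 : HasSum (fun v ↦ Complex.exp (-(2 * π * z * √(nsq v))) * (z⁻¹ ^ (1 / 2 : ℂ) / 2))
      (z⁻¹ * ∫ y in Ioi (0 : ℝ), ∑' v, G v y) :=
    hF1.congr_fun fun v ↦ ((integral_subordination hz (sqrt_nonneg _)).2).symm
  have hF3 := hF2.mul_right (2 * z ^ (1 / 2 : ℂ))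
  have hF4 : HasSum (fun v : ℤ × ℤ ↦ Complex.exp (-(2 * π * z * √(nsq v))))
      (z⁻¹ * (∫ y in Ioi (0 : ℝ), ∑' v, G v y) * (2 * z ^ (1 / 2 : ℂ))) := by
    refine hF3.congr_fun fun v ↦ ?_
    rw [inv_cpow_half hz]
    field_simp
  rw [hF4.tsum_eq]
  have hG3 := ((hG1.mul_left z⁻¹).mul_right (2 * z ^ (1 / 2 : ℂ)))
  refine hG3.congr_fun fun v ↦ ?_
  rw [(integral_sq_mul_cexp (re_add_div_pos (nsq_nonneg v) hz)).2, lker, sq_add_eq hz]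
  have := add_div_ne_zero (nsq_nonneg v) hz
  field_simp

lemma finite_nsq_le (x : ℝ) : {v : ℤ × ℤ | nsq v ≤ x}.Finite := by
  refine ((finite_Icc (-⌊√x⌋) ⌊√x⌋).prod (finite_Icc (-⌊√x⌋) ⌊√x⌋)).subset fun v hv ↦ ?_
  have hv : (v.1 : ℝ) ^ 2 + (v.2 : ℝ) ^ 2 ≤ x := hv
  have h1 : |(v.1 : ℝ)| ≤ √x := Real.abs_le_sqrt (by nlinarith [sq_nonneg (v.2 : ℝ)])
  have h2 : |(v.2 : ℝ)| ≤ √x := Real.abs_le_sqrt (by nlinarith [sq_nonneg (v.1 : ℝ)])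
  have key : ∀ n : ℤ, |(n : ℝ)| ≤ √x → n ∈ Icc (-⌊√x⌋) ⌊√x⌋ := fun n hn ↦ by
    have : |n| ≤ ⌊√x⌋ := Int.le_floor.2 (by exact_mod_cast hn)
    exact abs_le.1 this
  exact ⟨key _ h1, key _ h2⟩

lemma latticeA_le {x : ℝ} (hx : 0 ≤ x) : (latticeA x : ℝ) ≤ 9 * (1 + x) := by
  have hsub : {v : ℤ × ℤ | nsq v ≤ x} ⊆
      ((Finset.Icc (-⌊√x⌋) ⌊√x⌋ ×ˢ Finset.Icc (-⌊√x⌋) ⌊√x⌋ : Finset (ℤ × ℤ)) : Set (ℤ × ℤ)) := by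
    intro v hv
    have hv : (v.1 : ℝ) ^ 2 + (v.2 : ℝ) ^ 2 ≤ x := hv
    have h1 : |(v.1 : ℝ)| ≤ √x := Real.abs_le_sqrt (by nlinarith [sq_nonneg (v.2 : ℝ)])
    have h2 : |(v.2 : ℝ)| ≤ √x := Real.abs_le_sqrt (by nlinarith [sq_nonneg (v.1 : ℝ)])
    have key : ∀ n : ℤ, |(n : ℝ)| ≤ √x → n ∈ Finset.Icc (-⌊√x⌋) ⌊√x⌋ := fun n hn ↦ by
      have : |n| ≤ ⌊√x⌋ := Int.le_floor.2 (by exact_mod_cast hn)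
      exact Finset.mem_Icc.2 (abs_le.1 this)
    exact Finset.mem_coe.2 (Finset.mem_product.2 ⟨key _ h1, key _ h2⟩)
  have hcard : latticeA x ≤ _ := (Set.ncard_le_ncard hsub (Finset.finite_toSet _))
  rw [Set.ncard_coe_finset, Finset.card_product, Int.card_Icc] at hcard
  have h0 : 0 ≤ ⌊√x⌋ := Int.floor_nonneg.2 (sqrt_nonneg _)
  have hfl : (⌊√x⌋ : ℝ) ≤ √x := Int.floor_le _
  have h0' : (0 : ℝ) ≤ ⌊√x⌋ := by exact_mod_cast h0
  have hc : (((⌊√x⌋ + 1 - -⌊√x⌋).toNat : ℕ) : ℝ) = 2 * ⌊√x⌋ + 1 := by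
    have : (((⌊√x⌋ + 1 - -⌊√x⌋).toNat : ℕ) : ℤ) = 2 * ⌊√x⌋ + 1 := by
      rw [Int.toNat_of_nonneg (by omega)]; ring
    exact_mod_cast this
  have hcard' : (latticeA x : ℝ) ≤ (2 * ⌊√x⌋ + 1) * (2 * ⌊√x⌋ + 1) := by
    rw [← hc]; exact_mod_cast hcard
  nlinarith [Real.sq_sqrt hx, sq_nonneg (√x - 1)]

lemma abs_latticeP_le {x : ℝ} (hx : 0 ≤ x) : |latticeP x| ≤ 9 * (1 + x) := by
  have h := latticeA_le hx
  have h0 : (0 : ℝ) ≤ latticeA x := Nat.cast_nonneg _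
  have hpi := Real.pi_lt_four
  have hpi0 := Real.pi_pos
  unfold latticeP
  rw [abs_le]; constructor <;> nlinarith

lemma latticeA_mono : Monotone fun x : ℝ ↦ (latticeA x : ℝ) := fun x y hxy ↦ by
  have : latticeA x ≤ latticeA y :=
    Set.ncard_le_ncard (fun v (hv : nsq v ≤ x) ↦ hv.trans hxy) (finite_nsq_le y)
  exact Nat.cast_le.2 this

lemma measurable_latticeP_sq : Measurable fun t : ℝ ↦ latticeP (t ^ 2) :=
  (latticeA_mono.measurable.comp (measurable_id.pow_const 2)).sub
    ((measurable_id.pow_const 2).const_mul π)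

lemma hasSum_latticeA (t : ℝ) (ht : 0 ≤ t) (c : ℂ) :
    HasSum (fun v : ℤ × ℤ ↦ (Ici √(nsq v)).indicator (fun _ ↦ c) t) (latticeA (t ^ 2) * c) := by
  have hS := finite_nsq_le (t ^ 2)
  have hiff : ∀ v, √(nsq v) ≤ t ↔ nsq v ≤ t ^ 2 := fun v ↦ by
    rw [Real.sqrt_le_left ht]
  have h := hasSum_sum_of_ne_finset_zero (L := .unconditional _) (s := hS.toFinset)
    (f := fun v : ℤ × ℤ ↦ (Ici √(nsq v)).indicator (fun _ ↦ c) t) (fun v hv ↦ by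
      rw [Set.Finite.mem_toFinset, Set.mem_ofPred_eq, ← hiff] at hv
      exact indicator_of_notMem hv _)
  convert! h using 1
  rw [Finset.sum_congr rfl (g := fun _ ↦ c) fun v hv ↦ by
    rw [Set.Finite.mem_toFinset, Set.mem_ofPred_eq, ← hiff] at hv
    exact indicator_of_mem (show t ∈ Ici _ from hv) _]
  rw [Finset.sum_const, nsmul_eq_mul, ← Set.ncard_eq_toFinset_card _ hS]
  rfl

lemma norm_cexp_neg_mul (w : ℂ) (t : ℝ) : ‖Complex.exp (-(w * t))‖ = rexp (-w.re * t) := by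
  rw [Complex.norm_exp]; simp

lemma tendsto_pow_mul_cexp {w : ℂ} (hw : 0 < w.re) (n : ℕ) :
    Tendsto (fun t : ℝ ↦ (t : ℂ) ^ n * Complex.exp (-(w * t))) atTop (nhds 0) := by
  rw [tendsto_zero_iff_norm_tendsto_zero]
  have h := (Real.tendsto_pow_mul_exp_neg_atTop_nhds_zero n).comp (tendsto_id.const_mul_atTop hw)
  have h2 := h.const_mul ((w.re ^ n)⁻¹)
  rw [mul_zero] at h2
  refine h2.congr' ?_
  filter_upwards [eventually_gt_atTop 0] with t ht
  rw [norm_mul, norm_cexp_neg_mul, norm_pow, Complex.norm_real, Real.norm_of_nonneg ht.le]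
  simp only [Function.comp_apply, id]
  rw [mul_pow]
  field_simp

lemma integrableOn_pow_mul_exp {b : ℝ} (hb : 0 < b) (n : ℕ) :
    IntegrableOn (fun t : ℝ ↦ t ^ n * rexp (-b * t)) (Ioi 0) := by
  have h := integrableOn_rpow_mul_exp_neg_mul_rpow (p := 1) (s := n) (b := b)
    (by have : (0 : ℝ) ≤ n := Nat.cast_nonneg n
        linarith) one_pos hb
  refine h.congr_fun (fun t _ ↦ ?_) measurableSet_Ioi
  simp

lemma integrableOn_pow_mul_cexp {w : ℂ} (hw : 0 < w.re) (n : ℕ) :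
    IntegrableOn (fun t : ℝ ↦ (t : ℂ) ^ n * Complex.exp (-(w * t))) (Ioi 0) := by
  refine Integrable.mono (integrableOn_pow_mul_exp hw n)
    (by fun_prop) (.of_forall fun t ↦ ?_)
  rw [norm_mul, norm_cexp_neg_mul, norm_mul, norm_pow, Complex.norm_real, norm_pow,
    Real.norm_of_nonneg (exp_pos _).le]

lemma integral_sq_mul_cexp_neg {w : ℂ} (hw : 0 < w.re) :
    ∫ t in Ioi (0 : ℝ), (t : ℂ) ^ 2 * Complex.exp (-(w * t)) = 2 / w ^ 3 := by
  have hw0 := ne_zero_of_re hw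
  have h := integral_Ioi_of_hasDerivAt_of_tendsto' (a := 0) (m := 0)
    (f := fun t : ℝ ↦ -((t : ℂ) ^ 2 * Complex.exp (-(w * t)) / w +
      2 * ((t : ℂ) ^ 1 * Complex.exp (-(w * t))) / w ^ 2 +
      2 * ((t : ℂ) ^ 0 * Complex.exp (-(w * t))) / w ^ 3))
    (f' := fun t : ℝ ↦ (t : ℂ) ^ 2 * Complex.exp (-(w * t)))
    (fun t _ ↦ by
      have hi : HasDerivAt (fun t : ℝ ↦ (t : ℂ)) 1 t := Complex.ofRealCLM.hasDerivAt
      have he : HasDerivAt (fun t : ℝ ↦ Complex.exp (-(w * t)))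
        (Complex.exp (-(w * t)) * (-(w * 1))) t := ((hi.const_mul w).neg).cexp
      convert! ((((hi.pow 2).mul he).div_const w).add
        ((((hi.pow 1).mul he).const_mul 2).div_const (w ^ 2)) |>.add
        ((((hi.pow 0).mul he).const_mul 2).div_const (w ^ 3))).neg using 1
      simp only [Pi.pow_apply]
      field_simp
      push_cast
      ring)
    (integrableOn_pow_mul_cexp hw 2)
    (by
      have := ((((tendsto_pow_mul_cexp hw 2).div_const w).add
        (((tendsto_pow_mul_cexp hw 1).const_mul 2).div_const (w ^ 2))).add
        (((tendsto_pow_mul_cexp hw 0).const_mul 2).div_const (w ^ 3))).neg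
      simpa using this)
  rw [h]; simp

lemma integral_indicator_cexp {w : ℂ} (hw : 0 < w.re) {r : ℝ} (hr : 0 ≤ r) :
    IntegrableOn (fun t : ℝ ↦ (Ici r).indicator (fun _ ↦ w * Complex.exp (-(w * t))) t) (Ioi 0) ∧
    ∫ t in Ioi (0 : ℝ), (Ici r).indicator (fun _ ↦ w * Complex.exp (-(w * t))) t =
      Complex.exp (-(w * r)) ∧
    ∫ t in Ioi (0 : ℝ), ‖(Ici r).indicator (fun _ ↦ w * Complex.exp (-(w * t))) t‖ =
      ‖w‖ / w.re * rexp (-w.re * r) := by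
  have hw0 := ne_zero_of_re hw
  have hset : (Ioi (0 : ℝ) ∩ Ici r : Set ℝ) =ᵐ[volume] Ioi r := by
    rcases hr.eq_or_lt with rfl | hr
    · rw [inter_eq_left.2 Ioi_subset_Ici_self]; exact ae_eq_refl _
    · rw [inter_eq_right.2 (Ici_subset_Ioi.2 hr)]; exact Ioi_ae_eq_Ici.symm
  have hre : (-w).re < 0 := by simpa using hw
  have hexp : ∀ t : ℝ, Complex.exp (-(w * t)) = Complex.exp (-w * t) := fun t ↦ by rw [neg_mul]
  refine ⟨?_, ?_, ?_⟩
  · rw [show (fun t : ℝ ↦ (Ici r).indicator (fun _ ↦ w * Complex.exp (-(w * t))) t) =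
      (Ici r).indicator (fun t : ℝ ↦ w * Complex.exp (-(w * t))) from rfl]
    refine Integrable.indicator ?_ measurableSet_Ici
    simpa using (integrableOn_pow_mul_cexp hw 0).const_mul w
  · rw [show (fun t : ℝ ↦ (Ici r).indicator (fun _ ↦ w * Complex.exp (-(w * t))) t) =
      (Ici r).indicator (fun t : ℝ ↦ w * Complex.exp (-(w * t))) from rfl,
      setIntegral_indicator measurableSet_Ici, setIntegral_congr_set hset, integral_const_mul]
    simp_rw [hexp]
    rw [integral_exp_mul_complex_Ioi hre]
    field_simp
  · have : (fun t : ℝ ↦ ‖(Ici r).indicator (fun _ ↦ w * Complex.exp (-(w * t))) t‖) =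
      (Ici r).indicator (fun t : ℝ ↦ ‖w‖ * rexp (-w.re * t)) := by
      ext t
      by_cases h : t ∈ Ici r
      · rw [indicator_of_mem h, indicator_of_mem h, norm_mul, norm_cexp_neg_mul]
      · rw [indicator_of_notMem h, indicator_of_notMem h, norm_zero]
    rw [this, setIntegral_indicator measurableSet_Ici, setIntegral_congr_set hset,
      integral_const_mul, integral_exp_mul_Ioi (by linarith)]
    field_simp

lemma integral_latticeA {z : ℂ} (hz : 0 < z.re) :
    IntegrableOn (fun t : ℝ ↦ latticeA (t ^ 2) * Complex.exp (-(2 * π * z * t))) (Ioi 0) ∧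
    2 * π * z * ∫ t in Ioi (0 : ℝ), latticeA (t ^ 2) * Complex.exp (-(2 * π * z * t)) =
      ∑' v : ℤ × ℤ, Complex.exp (-(2 * π * z * √(nsq v))) := by
  have hw : 0 < (2 * π * z).re := by
    rw [show (2 * π * z : ℂ) = ((2 * π : ℝ) : ℂ) * z by push_cast; ring, Complex.re_ofReal_mul]
    positivity
  constructor
  · refine Integrable.mono' ((integrableOn_pow_mul_exp hw 0).const_mul 9 |>.add
      ((integrableOn_pow_mul_exp hw 2).const_mul 9)) ?_ (.of_forall fun t ↦ ?_)
    · refine Measurable.aestronglyMeasurable ?_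
      refine Measurable.mul ?_ (by fun_prop)
      have := Complex.measurable_ofReal.comp
        (latticeA_mono.measurable.comp (measurable_id.pow_const 2))
      exact this
    · rw [norm_mul, norm_cexp_neg_mul, Complex.norm_natCast]
      have := latticeA_le (sq_nonneg t)
      simp only [Pi.add_apply]
      have he := exp_pos (-(2 * π * z).re * t)
      nlinarith
  · rw [← integral_const_mul]
    have h := hasSum_integral_of_summable_integral_norm (μ := volume.restrict (Ioi (0 : ℝ)))
      (F := fun (v : ℤ × ℤ) (t : ℝ) ↦ (Ici √(nsq v)).indicator
        (fun _ ↦ (2 * π * z) * Complex.exp (-(2 * π * z * t))) t)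
      (fun v ↦ (integral_indicator_cexp hw (sqrt_nonneg _)).1)
      (by
        simp_rw [(integral_indicator_cexp hw (sqrt_nonneg _)).2.2]
        exact (summable_exp_neg_sqrt_nsq hw).mul_left _)
    simp_rw [(integral_indicator_cexp hw (sqrt_nonneg _)).2.1] at h
    rw [h.tsum_eq]
    refine setIntegral_congr_fun measurableSet_Ioi fun t ht ↦ ?_
    rw [(hasSum_latticeA t (le_of_lt ht) _).tsum_eq]
    ring

lemma two_pi_mul_re {z : ℂ} (hz : 0 < z.re) : 0 < (2 * π * z).re := by
  rw [show (2 * π * z : ℂ) = ((2 * π : ℝ) : ℂ) * z by push_cast; ring, Complex.re_ofReal_mul]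
  positivity

lemma integrableOn_latticeP {z : ℂ} (hz : 0 < z.re) :
    IntegrableOn (fun t : ℝ ↦ latticeP (t ^ 2) * Complex.exp (-(2 * π * z * t))) (Ioi 0) := by
  have h1 := (integral_latticeA hz).1
  have h2 := (integrableOn_pow_mul_cexp (two_pi_mul_re hz) 2).const_mul (π : ℂ)
  refine (h1.sub h2).congr_fun (fun t _ ↦ ?_) measurableSet_Ioi
  simp only [latticeP, Pi.sub_apply]
  push_cast
  ring

lemma hasSum_laplace_latticeP {z : ℂ} (hz : 0 < z.re) :
    HasSum (fun v : ℤ × ℤ ↦ if v = 0 then 0 else lker (nsq v) z / (4 * π ^ 2 * z * (z ^ 2 + nsq v)))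
      (∫ t in Ioi (0 : ℝ), latticeP (t ^ 2) * Complex.exp (-(2 * π * z * t))) := by
  have hz0 := ne_zero_of_re hz
  have hpi : (π : ℂ) ≠ 0 := by exact_mod_cast pi_ne_zero
  have h1 := integral_latticeA hz
  have h2 := (integrableOn_pow_mul_cexp (two_pi_mul_re hz) 2).const_mul (π : ℂ)
  have hP : ∫ t in Ioi (0 : ℝ), latticeP (t ^ 2) * Complex.exp (-(2 * π * z * t)) =
      (∑' v : ℤ × ℤ, Complex.exp (-(2 * π * z * √(nsq v)))) / (2 * π * z) -
        1 / (4 * π ^ 2 * z ^ 3) := by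
    rw [← h1.2, mul_div_cancel_left₀ _ (by simp [hpi, hz0])]
    have : (1 / (4 * π ^ 2 * z ^ 3) : ℂ) = π * (2 / (2 * π * z) ^ 3) := by field_simp; norm_num
    rw [this, ← integral_sq_mul_cexp_neg (two_pi_mul_re hz), ← integral_const_mul,
      ← integral_sub h1.1 h2]
    refine setIntegral_congr_fun measurableSet_Ioi fun t _ ↦ ?_
    simp only [latticeP]
    push_cast
    ring
  have h3 := hasSum_ite_sub_hasSum ((hasSum_lker hz).div_const (2 * π * z)) 0
  rw [hP]
  convert! h3 using 1
  · ext v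
    split_ifs
    · rfl
    · rw [div_div]; congr 1; ring
  · rw [nsq_zero, lker_zero hz]
    congr 1
    push_cast
    field_simp
    norm_num

lemma hasDerivAt_lker {a : ℝ} (ha : 0 ≤ a) {z : ℂ} (hz : 0 < z.re) :
    HasDerivAt (lker a) (a * (lker a z / (z * (z ^ 2 + a)))) z := by
  have hz0 := ne_zero_of_re hz
  have hw := re_add_div_pos ha hz
  have hw0 := add_div_ne_zero ha hz
  have h1 : HasDerivAt (fun z : ℂ ↦ z ^ (1 / 2 : ℂ)) _ z :=
    (hasDerivAt_id z).cpow_const (c := 1 / 2) (Or.inl hz)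
  have h2 : HasDerivAt (fun z : ℂ ↦ (z + a / z)⁻¹)
      (-(1 + a * (-(z ^ 2)⁻¹)) / (z + a / z) ^ 2) z := by
    have := ((hasDerivAt_id z).add ((hasDerivAt_inv hz0).const_mul (a : ℂ))).inv hw0
    exact this
  have h3 : HasDerivAt (fun z : ℂ ↦ (z + a / z)⁻¹ ^ (1 / 2 : ℂ)) _ z :=
    h2.cpow_const (c := 1 / 2) (Or.inl (inv_re_pos hw))
  convert! h1.mul h3 using 1
  rw [Complex.cpow_sub _ _ (by exact hz0), Complex.cpow_sub _ _ (inv_ne_zero hw0),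
    Complex.cpow_one, Complex.cpow_one]
  rw [lker, sq_add_eq hz]
  simp only [id]
  generalize z ^ (1 / 2 : ℂ) = p
  generalize (z + a / z)⁻¹ ^ (1 / 2 : ℂ) = q
  have hw1 : z ^ 2 + a ≠ 0 := by rw [sq_add_eq hz]; exact mul_ne_zero hz0 hw0
  have : z + a / z = (z ^ 2 + a) / z := by field_simp
  rw [this]
  field_simp
  ring

lemma mul_re_div_norm_le_norm_sq_add {a : ℝ} {z : ℂ} (hz : 0 < z.re) :
    a * z.re / ‖z‖ ≤ ‖z ^ 2 + a‖ := by
  have hn : 0 < ‖z‖ := norm_pos_iff.2 (ne_zero_of_re hz)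
  rw [sq_add_eq hz, norm_mul]
  have h1 : a * z.re / ‖z‖ ^ 2 ≤ ‖z + a / z‖ := by
    refine le_trans ?_ (Complex.re_le_norm _)
    rw [Complex.add_re, div_eq_mul_inv (a : ℂ), Complex.re_ofReal_mul, Complex.inv_re,
      Complex.normSq_eq_norm_sq, mul_div_assoc]
    linarith
  calc a * z.re / ‖z‖ = ‖z‖ * (a * z.re / ‖z‖ ^ 2) := by field_simp
    _ ≤ _ := by gcongr

lemma norm_lker_sq (a : ℝ) {z : ℂ} (hz : 0 < z.re) :
    ‖lker a z‖ ^ 2 = ‖z‖ ^ 2 / ‖z ^ 2 + a‖ := by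
  rw [← norm_pow, lker_sq a hz, norm_div, norm_pow]

lemma norm_lker_sq_le {a : ℝ} (ha : 0 < a) {z : ℂ} (hz : 0 < z.re) :
    ‖lker a z‖ ^ 2 ≤ ‖z‖ ^ 3 / (a * z.re) := by
  have hn : 0 < ‖z‖ := norm_pos_iff.2 (ne_zero_of_re hz)
  rw [norm_lker_sq a hz]
  calc ‖z‖ ^ 2 / ‖z ^ 2 + a‖ ≤ ‖z‖ ^ 2 / (a * z.re / ‖z‖) := by
        gcongr
        exact mul_re_div_norm_le_norm_sq_add hz
    _ = _ := by field_simp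

lemma norm_lker_div_le {a : ℝ} (ha : 0 < a) {z : ℂ} (hz : 0 < z.re) :
    ‖lker a z / (z * (z ^ 2 + a))‖ ≤ (‖z‖ / z.re) ^ (3 / 2 : ℝ) * a ^ (-(3 / 2) : ℝ) := by
  have hn : 0 < ‖z‖ := norm_pos_iff.2 (ne_zero_of_re hz)
  have h0 := mul_re_div_norm_le_norm_sq_add (a := a) hz
  have hpos : 0 < a * z.re / ‖z‖ := by positivity
  have hd := hpos.trans_le h0
  have hr : (‖z‖ / z.re) ^ (3 / 2 : ℝ) * a ^ (-(3 / 2) : ℝ) =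
      (a * z.re / ‖z‖) ^ (-(3 / 2) : ℝ) := by
    rw [mul_div_assoc, mul_rpow ha.le (by positivity), ← inv_div, inv_rpow (by positivity),
      ← rpow_neg (by positivity)]
    ring
  rw [hr]
  refine le_trans (le_of_eq ?_) (rpow_le_rpow_of_nonpos hpos h0 (by norm_num))
  rw [← sq_eq_sq₀ (norm_nonneg _) (rpow_nonneg (norm_nonneg _) _), norm_div, div_pow, norm_mul,
    mul_pow, norm_lker_sq a hz, ← rpow_natCast (_ ^ _), ← rpow_mul (norm_nonneg _)]
  have : ‖z ^ 2 + a‖ ^ (-(3 / 2) * (2 : ℕ) : ℝ) = (‖z ^ 2 + a‖ ^ 3)⁻¹ := by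
    rw [← rpow_natCast, ← rpow_neg (norm_nonneg _)]; norm_num
  rw [this]
  field_simp

lemma re_cpow_half_nonneg (z : ℂ) : 0 ≤ (z ^ (1 / 2 : ℂ)).re := by
  rcases eq_or_ne z 0 with rfl | hz
  · simp
  rw [Complex.cpow_def_of_ne_zero hz, Complex.exp_re]
  refine mul_nonneg (exp_pos _).le (Real.cos_nonneg_of_mem_Icc ?_)
  have h1 := Complex.neg_pi_lt_arg z
  have h2 := Complex.arg_le_pi z
  have : (Complex.log z * (1 / 2)).im = z.arg / 2 := by
    rw [show (1 / 2 : ℂ) = ((1 / 2 : ℝ) : ℂ) by push_cast; rfl,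
      Complex.im_mul_ofReal, Complex.log_im]
    ring
  rw [this]
  constructor <;> linarith

lemma abs_im_cpow_half_le {z : ℂ} (hz : 0 < z.re) :
    |(z ^ (1 / 2 : ℂ)).im| ≤ (z ^ (1 / 2 : ℂ)).re := by
  have h := cpow_half_mul_self (z := z)
  have h1 : (z ^ (1 / 2 : ℂ)).re * (z ^ (1 / 2 : ℂ)).re -
    (z ^ (1 / 2 : ℂ)).im * (z ^ (1 / 2 : ℂ)).im = z.re := by rw [← Complex.mul_re, h]
  refine abs_le_of_sq_le_sq ?_ (re_cpow_half_nonneg z)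
  nlinarith

lemma re_lker_nonneg {a : ℝ} (ha : 0 ≤ a) {z : ℂ} (hz : 0 < z.re) : 0 ≤ (lker a z).re := by
  have h1 := abs_im_cpow_half_le hz
  have h2 := abs_im_cpow_half_le (inv_re_pos (re_add_div_pos ha hz))
  rw [lker, Complex.mul_re]
  have := mul_le_mul h1 h2 (abs_nonneg _) ((abs_nonneg _).trans h1)
  rw [← abs_mul] at this
  linarith [le_abs_self ((z ^ (1 / 2 : ℂ)).im * ((z + a / z)⁻¹ ^ (1 / 2 : ℂ)).im)]

lemma le_re_lker {m : ℝ} (hm : 0 < m) {σ γ : ℝ} (hσ : 0 < σ) (hγ : √m ≤ |γ|) :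
    m ^ (1 / 4 : ℝ) / 2 * (σ ^ 2 + (|γ| - √m) ^ 2) ^ (-(1 / 4) : ℝ) ≤
      (lker m (σ + γ * Complex.I)).re := by
  set z : ℂ := σ + γ * Complex.I with hzdef
  have hre : z.re = σ := by simp [hzdef]
  have him : z.im = γ := by simp [hzdef]
  have hz : 0 < z.re := by rwa [hre]
  have hz0 := ne_zero_of_re hz
  have hs : 0 < √m := sqrt_pos.2 hm
  have hms : √m ^ 2 = m := sq_sqrt hm.le
  have hγ2 : m ≤ γ ^ 2 := by rw [← hms, ← sq_abs γ]; gcongr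
  have hnz : ‖z‖ ^ 2 = σ ^ 2 + γ ^ 2 := by
    rw [← Complex.normSq_eq_norm_sq, Complex.normSq_apply, hre, him]; ring
  have hzz : z ^ 2 + m ≠ 0 := by
    rw [sq_add_eq hz]; exact mul_ne_zero hz0 (add_div_ne_zero hm.le hz)
  have hsqre : (z ^ 2).re = σ ^ 2 - γ ^ 2 := by rw [sq, Complex.mul_re, hre, him]; ring
  have hsqim : (z ^ 2).im = 2 * σ * γ := by rw [sq, Complex.mul_im, hre, him]; ring
  have hre2 : 0 ≤ (lker m z ^ 2).re := by
    rw [lker_sq m hz, Complex.div_re]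
    rw [Complex.add_re, Complex.add_im, hsqre, hsqim, Complex.ofReal_re, Complex.ofReal_im,
      ← add_div]
    refine div_nonneg ?_ (Complex.normSq_nonneg _)
    nlinarith [sq_nonneg σ, sq_nonneg γ, mul_nonneg (sq_nonneg γ) (sub_nonneg.2 hγ2),
      mul_nonneg (sq_nonneg σ) (sq_nonneg γ), mul_nonneg (sq_nonneg σ) (sq_nonneg σ),
      mul_nonneg (sq_nonneg σ) hm.le]
  have hle : ‖lker m z‖ ^ 2 ≤ 2 * (lker m z).re ^ 2 := by
    rw [← Complex.normSq_eq_norm_sq, Complex.normSq_apply]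
    rw [sq, Complex.mul_re] at hre2
    nlinarith
  set Q := σ ^ 2 + (|γ| - √m) ^ 2 with hQ
  have hQ0 : 0 < Q := by positivity
  have hb : ‖z ^ 2 + m‖ ≤ 2 * ‖z‖ * √Q := by
    refine le_of_sq_le_sq ?_ (by positivity)
    rw [mul_pow, mul_pow, hnz, sq_sqrt hQ0.le, ← Complex.normSq_eq_norm_sq, Complex.normSq_apply,
      Complex.add_re, Complex.add_im, hsqre, hsqim, Complex.ofReal_re, Complex.ofReal_im, hQ,
      ← sq_abs γ]
    have hgg : (2 * σ * γ + 0) * (2 * σ * γ + 0) = 4 * σ ^ 2 * |γ| ^ 2 := by rw [sq_abs]; ring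
    rw [hgg]
    generalize |γ| = g at *
    have e : (σ ^ 2 - g ^ 2 + m) * (σ ^ 2 - g ^ 2 + m) + 4 * σ ^ 2 * g ^ 2 =
      (σ ^ 2 + (g - √m) ^ 2) * (σ ^ 2 + (g + √m) ^ 2) := by
      nth_rewrite 1 2 [← hms]; ring
    rw [e, mul_comm]
    gcongr
    nlinarith
  have hzs : √m ≤ ‖z‖ := hγ.trans (by rw [← him]; exact Complex.abs_im_le_norm z)
  have hnl : √m / (2 * √Q) ≤ ‖lker m z‖ ^ 2 := by
    rw [norm_lker_sq m hz]
    calc √m / (2 * √Q) ≤ ‖z‖ / (2 * √Q) := by gcongr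
      _ = ‖z‖ ^ 2 / (2 * ‖z‖ * √Q) := by
        have : 0 < ‖z‖ := hs.trans_le hzs
        field_simp
      _ ≤ _ := by gcongr
  have hfin : (m ^ (1 / 4 : ℝ) / 2 * Q ^ (-(1 / 4) : ℝ)) ^ 2 = √m / (4 * √Q) := by
    rw [mul_pow, div_pow, ← rpow_natCast (m ^ _), ← rpow_natCast (Q ^ _), ← rpow_mul hm.le,
      ← rpow_mul hQ0.le, sqrt_eq_rpow, sqrt_eq_rpow]
    norm_num
    rw [rpow_neg hQ0.le]
    field_simp
  refine le_of_sq_le_sq ?_ (re_lker_nonneg hm.le hz)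
  rw [hfin]
  have : √m / (4 * √Q) = (√m / (2 * √Q)) / 2 := by field_simp; norm_num
  rw [this]
  linarith

/-- The smoothing weight `(1 - exp (-2πt)) / t`. -/
noncomputable def wgt (t : ℝ) : ℝ := (1 - rexp (-(2 * π * t))) / t

lemma wgt_nonneg {t : ℝ} (ht : 0 < t) : 0 ≤ wgt t := by
  refine div_nonneg ?_ ht.le
  rw [sub_nonneg, Real.exp_le_one_iff]
  have := pi_pos
  nlinarith

lemma wgt_le {t : ℝ} (ht : 0 < t) : wgt t ≤ 2 * π := by
  rw [wgt, div_le_iff₀ ht]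
  linarith [Real.add_one_le_exp (-(2 * π * t))]

lemma wgt_le_inv {t : ℝ} (ht : 0 < t) : wgt t ≤ 1 / t := by
  rw [wgt]; gcongr
  linarith [exp_pos (-(2 * π * t))]

lemma integral_cexp_eq_wgt {t : ℝ} (ht : 0 < t) :
    ∫ x in Ioc (0 : ℝ) 1, (2 * π : ℂ) * Complex.exp (-(2 * π * x * t)) = wgt t := by
  have hpi : (π : ℂ) ≠ 0 := by exact_mod_cast pi_ne_zero
  have ht' : (t : ℂ) ≠ 0 := by exact_mod_cast ht.ne'
  rw [← intervalIntegral.integral_of_le zero_le_one]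
  have := intervalIntegral.integral_eq_sub_of_hasDerivAt (a := 0) (b := 1)
    (f := fun x : ℝ ↦ -Complex.exp (-(2 * π * x * t)) / t)
    (f' := fun x : ℝ ↦ (2 * π : ℂ) * Complex.exp (-(2 * π * x * t)))
    (fun x _ ↦ by
      have hi : HasDerivAt (fun t : ℝ ↦ (t : ℂ)) 1 x := Complex.ofRealCLM.hasDerivAt
      convert! ((((hi.const_mul (2 * π : ℂ)).mul_const (t : ℂ)).neg.cexp).neg).div_const
        (t : ℂ) using 1
      simp only [Pi.neg_apply]
      field_simp)
    ((by fun_prop : Continuous fun x : ℝ ↦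
      (2 * π : ℂ) * Complex.exp (-(2 * π * x * t))).intervalIntegrable _ _)
  rw [this, wgt]
  push_cast
  simp
  ring

lemma integral_lker_div {a : ℝ} (ha : 0 < a) {z : ℂ} (hz : 0 < z.re) :
    ContinuousOn (fun x : ℝ ↦ lker a (z + x) / ((z + x) * ((z + x) ^ 2 + a))) (Icc 0 1) ∧
    ∫ x in Ioc (0 : ℝ) 1, lker a (z + x) / ((z + x) * ((z + x) ^ 2 + a)) =
      (lker a (z + 1) - lker a z) / a := by
  have hre : ∀ x ∈ Icc (0 : ℝ) 1, 0 < (z + x).re := fun x hx ↦ by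
    simp only [Complex.add_re, Complex.ofReal_re]; linarith [hx.1]
  have hd : ∀ x ∈ Icc (0 : ℝ) 1, HasDerivAt (fun x : ℝ ↦ lker a (z + x))
      (a * (lker a (z + x) / ((z + x) * ((z + x) ^ 2 + a)))) x := fun x hx ↦ by
    have hi : HasDerivAt (fun t : ℝ ↦ z + (t : ℂ)) 1 x :=
      (Complex.ofRealCLM.hasDerivAt (x := x)).const_add z
    convert! (hasDerivAt_lker ha.le (hre x hx)).comp x hi using 1
    ring
  have hc : ContinuousOn (fun x : ℝ ↦ lker a (z + x) / ((z + x) * ((z + x) ^ 2 + a)))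
      (Icc 0 1) := by
    refine ContinuousOn.div (fun x hx ↦ (hd x hx).continuousAt.continuousWithinAt) (by fun_prop)
      fun x hx ↦ ?_
    have := hre x hx
    rw [sq_add_eq this]
    exact mul_ne_zero (ne_zero_of_re this)
      (mul_ne_zero (ne_zero_of_re this) (add_div_ne_zero ha.le this))
  refine ⟨hc, ?_⟩
  rw [← intervalIntegral.integral_of_le zero_le_one]
  have h := intervalIntegral.integral_eq_sub_of_hasDerivAt (a := 0) (b := 1)
    (fun x hx ↦ hd x (by rwa [uIcc_of_le zero_le_one] at hx))
    (ContinuousOn.intervalIntegrable (by rw [uIcc_of_le zero_le_one]; exact hc.const_smul (a : ℂ)))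
  rw [intervalIntegral.integral_const_mul] at h
  have ha' : (a : ℂ) ≠ 0 := by exact_mod_cast ha.ne'
  rw [eq_div_iff ha', mul_comm, h]
  simp

/-- The Laplace transform of the weighted discrepancy. -/
noncomputable def bfun (z : ℂ) : ℂ :=
  ∫ t in Ioi (0 : ℝ), latticeP (t ^ 2) * wgt t * Complex.exp (-(2 * π * z * t))

lemma measurable_wgt : Measurable wgt := by unfold wgt; fun_prop

lemma integrableOn_latticeP_wgt {z : ℂ} (hz : 0 < z.re) :
    IntegrableOn (fun t : ℝ ↦ latticeP (t ^ 2) * wgt t * Complex.exp (-(2 * π * z * t)))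
      (Ioi 0) := by
  refine Integrable.mono (Integrable.const_mul (integrableOn_latticeP hz) (2 * π : ℂ)) ?_ ?_
  · refine Measurable.aestronglyMeasurable ?_
    exact ((Complex.measurable_ofReal.comp measurable_latticeP_sq).mul
      (Complex.measurable_ofReal.comp measurable_wgt)).mul (by fun_prop)
  · refine (ae_restrict_iff' measurableSet_Ioi).2 (.of_forall fun t ht ↦ ?_)
    have ht : 0 < t := ht
    have h1 := wgt_le ht
    have h2 := wgt_nonneg ht
    simp only [norm_mul, Complex.norm_real, Real.norm_of_nonneg h2, RCLike.norm_ofNat,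
      Real.norm_of_nonneg pi_pos.le]
    rw [mul_comm ‖latticeP _‖, mul_assoc]
    gcongr

lemma hasSum_bfun {z : ℂ} (hz : 0 < z.re) :
    HasSum (fun v : ℤ × ℤ ↦
      if v = 0 then 0 else (lker (nsq v) (z + 1) - lker (nsq v) z) / (2 * π * nsq v)) (bfun z) := by
  have hpi : (π : ℂ) ≠ 0 := by exact_mod_cast pi_ne_zero
  have hre : ∀ x ∈ Ioc (0 : ℝ) 1, 0 < (z + x).re := fun x hx ↦ by
    simp only [Complex.add_re, Complex.ofReal_re]; linarith [hx.1]
  have hB : bfun z = ∫ x in Ioc (0 : ℝ) 1, 2 * π * ∫ t in Ioi (0 : ℝ),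
      latticeP (t ^ 2) * Complex.exp (-(2 * π * (z + x) * t)) := by
    have h1 : bfun z = ∫ t in Ioi (0 : ℝ), ∫ x in Ioc (0 : ℝ) 1,
        (latticeP (t ^ 2) * Complex.exp (-(2 * π * z * t))) *
          ((2 * π : ℂ) * Complex.exp (-(2 * π * x * t))) := by
      refine setIntegral_congr_fun measurableSet_Ioi fun t ht ↦ ?_
      rw [integral_const_mul, integral_cexp_eq_wgt ht]
      ring
    rw [h1, integral_integral_swap]
    · refine setIntegral_congr_fun measurableSet_Ioc fun x _ ↦ ?_
      rw [← integral_const_mul]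
      refine setIntegral_congr_fun measurableSet_Ioi fun t _ ↦ ?_
      rw [show -(2 * π * (z + x) * t) = -(2 * π * z * t) + -(2 * π * x * t) by ring,
        Complex.exp_add]
      ring
    · have hb : Integrable (fun _ : ℝ ↦ (2 * π : ℂ)) (volume.restrict (Ioc (0 : ℝ) 1)) :=
        integrable_const _
      refine ((Integrable.mul_prod (integrableOn_latticeP hz) hb)).mono ?_ ?_
      · refine AEStronglyMeasurable.mul ?_ (by fun_prop)
        exact (integrableOn_latticeP hz).aestronglyMeasurable.comp_fst
      · rw [Measure.prod_restrict]
        refine (ae_restrict_iff' (measurableSet_Ioi.prod measurableSet_Ioc)).2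
          (.of_forall fun p hp ↦ ?_)
        rw [norm_mul _ (2 * π : ℂ)]
        simp only [Function.uncurry]
        rw [norm_mul _ ((2 * π : ℂ) * _), norm_mul (2 * π : ℂ)]
        refine mul_le_mul_of_nonneg_left ?_ (norm_nonneg _)
        refine mul_le_of_le_one_right (norm_nonneg _) ?_
        rw [Complex.norm_exp, Real.exp_le_one_iff]
        have : (-(2 * π * p.2 * p.1) : ℂ) = ((-(2 * π * p.2 * p.1) : ℝ) : ℂ) := by push_cast; rfl
        rw [this, Complex.ofReal_re]
        have h1 : 0 < p.1 := hp.1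
        have h2 : 0 < p.2 := hp.2.1
        have := pi_pos
        rw [neg_nonpos]
        positivity
  set F : ℤ × ℤ → ℝ → ℂ := fun v x ↦ if v = 0 then 0 else
    (lker (nsq v) (z + x) / ((z + x) * ((z + x) ^ 2 + nsq v))) * (2 * (π : ℂ))⁻¹ with hF
  have hF1 : ∀ x ∈ Ioc (0 : ℝ) 1, HasSum (fun v ↦ F v x) (2 * π * ∫ t in Ioi (0 : ℝ),
      latticeP (t ^ 2) * Complex.exp (-(2 * π * (z + x) * t))) := fun x hx ↦ by
    refine ((hasSum_laplace_latticeP (hre x hx)).mul_left (2 * π : ℂ)).congr_fun fun v ↦ ?_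
    simp only [hF]
    split_ifs
    · simp
    · have h0 := ne_zero_of_re (hre x hx)
      field_simp
      norm_num
  set C := ((‖z‖ + 1) / z.re) ^ (3 / 2 : ℝ) * (2 * π)⁻¹ with hC
  have hC0 : 0 ≤ C := by positivity
  have hb : ∀ v, ∀ x ∈ Ioc (0 : ℝ) 1, ‖F v x‖ ≤ C * nsq v ^ (-(3 / 2) : ℝ) := fun v x hx ↦ by
    simp only [hF]
    split_ifs with h
    · rw [norm_zero]; exact mul_nonneg hC0 (rpow_nonneg (nsq_nonneg _) _)
    · have h1 := norm_lker_div_le (zero_lt_one.trans_le (one_le_nsq h)) (hre x hx)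
      rw [norm_mul, hC, mul_right_comm]
      have h2 : ‖(2 * π : ℂ)⁻¹‖ = (2 * π)⁻¹ := by
        rw [norm_inv, norm_mul, Complex.norm_real, Real.norm_of_nonneg pi_pos.le]; norm_num
      rw [h2]
      gcongr
      refine h1.trans ?_
      refine mul_le_mul_of_nonneg_right (rpow_le_rpow
        (div_nonneg (norm_nonneg _) (hre x hx).le) ?_ (by norm_num)) (rpow_nonneg (nsq_nonneg _) _)
      refine div_le_div₀ (by positivity) ?_ hz ?_
      · refine (norm_add_le _ _).trans ?_
        rw [Complex.norm_real, Real.norm_of_nonneg hx.1.le]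
        linarith [hx.2]
      · simp [hx.1.le]
  have hi : ∀ v, Integrable (F v) (volume.restrict (Ioc (0 : ℝ) 1)) := fun v ↦ by
    simp only [hF]
    split_ifs with h
    · exact integrable_zero _ _ _
    · refine Integrable.mul_const ?_ _
      exact ((integral_lker_div (zero_lt_one.trans_le (one_le_nsq h)) hz).1
        |>.integrableOn_Icc).mono_set
        Ioc_subset_Icc_self
  have hs := hasSum_integral_of_summable_integral_norm hi
    ((summable_nsq_rpow.mul_left C).of_nonneg_of_le (fun v ↦ integral_nonneg fun _ ↦ norm_nonneg _)
    fun v ↦ by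
      calc ∫ x in Ioc (0 : ℝ) 1, ‖F v x‖ ≤ ∫ x in Ioc (0 : ℝ) 1, C * nsq v ^ (-(3 / 2) : ℝ) :=
          setIntegral_mono_on (hi v).norm (integrable_const _) measurableSet_Ioc (hb v)
        _ = _ := by simp)
  rw [hB, setIntegral_congr_fun measurableSet_Ioc fun x hx ↦ (hF1 x hx).tsum_eq.symm]
  refine hs.congr_fun fun v ↦ ?_
  simp only [hF]
  split_ifs with h
  · simp
  · rw [integral_mul_const, (integral_lker_div (zero_lt_one.trans_le (one_le_nsq h)) hz).2]
    have : (nsq v : ℂ) ≠ 0 := by exact_mod_cast (zero_lt_one.trans_le (one_le_nsq h)).ne'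
    field_simp

/-- The operator dual to multiplication by `1 + cos (2πat)`. -/
noncomputable def shiftOp (a : ℝ) (φ : ℝ → ℝ) (γ : ℝ) : ℝ :=
  φ γ + 1 / 2 * φ (γ + a) + 1 / 2 * φ (γ - a)

/-- The operator dual to multiplication by a Riesz product. -/
noncomputable def rieszOp (l : List ℝ) (φ : ℝ → ℝ) : ℝ → ℝ := l.foldr shiftOp φ

/-- The Riesz product with frequencies `l`. -/
noncomputable def rieszProd (l : List ℝ) (t : ℝ) : ℝ :=
  (l.map fun a ↦ 1 + cos (2 * π * t * a)).prod

lemma rieszOp_cons (a : ℝ) (l : List ℝ) (φ : ℝ → ℝ) :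
    rieszOp (a :: l) φ = shiftOp a (rieszOp l φ) := rfl

lemma shiftOp_comm (a b : ℝ) (φ : ℝ → ℝ) :
    shiftOp a (shiftOp b φ) = shiftOp b (shiftOp a φ) := by
  ext γ
  simp only [shiftOp]
  rw [show γ + a + b = γ + b + a by ring, show γ + a - b = γ - b + a by ring,
    show γ - a + b = γ + b - a by ring, show γ - a - b = γ - b - a by ring]
  ring

lemma rieszOp_perm {l l' : List ℝ} (h : l.Perm l') (φ : ℝ → ℝ) : rieszOp l φ = rieszOp l' φ :=
  have : LeftCommutative shiftOp := ⟨shiftOp_comm⟩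
  h.foldr_eq φ

lemma rieszOp_cons' (a : ℝ) (l : List ℝ) (φ : ℝ → ℝ) :
    rieszOp (a :: l) φ = rieszOp l (shiftOp a φ) := by
  induction l with
  | nil => rfl
  | cons b l ih => rw [rieszOp_cons, rieszOp_cons, shiftOp_comm, ← rieszOp_cons a, ih,
      ← rieszOp_cons]

lemma rieszOp_mono {l : List ℝ} {φ ψ : ℝ → ℝ} (h : ∀ γ, φ γ ≤ ψ γ) (γ : ℝ) :
    rieszOp l φ γ ≤ rieszOp l ψ γ := by
  induction l generalizing γ with
  | nil => exact h γ
  | cons a l ih =>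
    rw [rieszOp_cons, rieszOp_cons, shiftOp, shiftOp]
    linarith [ih γ, ih (γ + a), ih (γ - a)]

lemma rieszOp_const_mul (l : List ℝ) (c : ℝ) (φ : ℝ → ℝ) (γ : ℝ) :
    rieszOp l (fun γ ↦ c * φ γ) γ = c * rieszOp l φ γ := by
  induction l generalizing γ with
  | nil => rfl
  | cons a l ih => simp only [rieszOp_cons, shiftOp, ih]; ring

lemma rieszOp_sub (l : List ℝ) (φ ψ : ℝ → ℝ) (γ : ℝ) :
    rieszOp l (fun γ ↦ φ γ - ψ γ) γ = rieszOp l φ γ - rieszOp l ψ γ := by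
  induction l generalizing γ with
  | nil => rfl
  | cons a l ih => simp only [rieszOp_cons, shiftOp, ih]; ring

lemma rieszOp_nonneg {l : List ℝ} {φ : ℝ → ℝ} (h : ∀ γ, 0 ≤ φ γ) (γ : ℝ) : 0 ≤ rieszOp l φ γ := by
  have := rieszOp_mono (l := l) (φ := fun γ ↦ 0 * φ γ) (ψ := φ) (by simpa using h) γ
  rwa [rieszOp_const_mul, zero_mul] at this

lemma le_rieszOp {l : List ℝ} {φ : ℝ → ℝ} (h : ∀ γ, 0 ≤ φ γ) (γ : ℝ) : φ γ ≤ rieszOp l φ γ := by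
  induction l generalizing γ with
  | nil => exact le_rfl
  | cons a l ih =>
    rw [rieszOp_cons, shiftOp]
    linarith [ih γ, rieszOp_nonneg (l := l) h (γ + a), rieszOp_nonneg (l := l) h (γ - a)]

lemma rieszOp_le {l : List ℝ} (hl : ∀ a ∈ l, 0 ≤ a) {φ : ℝ → ℝ} {C G : ℝ}
    (h : ∀ γ, |γ| ≤ G → φ γ ≤ C) {γ : ℝ} (hγ : |γ| + l.sum ≤ G) :
    rieszOp l φ γ ≤ 2 ^ l.length * C := by
  induction l generalizing γ with
  | nil => simpa [rieszOp] using h γ (by simpa using hγ)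
  | cons a l ih =>
    have ha := hl a (by simp)
    have ih := fun γ ↦ @ih (fun b hb ↦ hl b (by simp [hb])) γ
    rw [List.sum_cons] at hγ
    have h1 := abs_add_le γ a
    have h2 := abs_sub γ a
    rw [abs_of_nonneg ha] at h1 h2
    rw [rieszOp_cons, shiftOp, List.length_cons, pow_succ]
    linarith [ih γ (by linarith), ih (γ + a) (by linarith), ih (γ - a) (by linarith)]

lemma hasSum_rieszOp {ι : Type*} {l : List ℝ} {φ : ι → ℝ → ℝ} {Φ : ℝ → ℝ}
    (h : ∀ γ, HasSum (fun v ↦ φ v γ) (Φ γ)) (γ : ℝ) :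
    HasSum (fun v ↦ rieszOp l (φ v) γ) (rieszOp l Φ γ) := by
  induction l generalizing γ with
  | nil => exact h γ
  | cons a l ih =>
    exact ((ih γ).add ((ih (γ + a)).mul_left _)).add ((ih (γ - a)).mul_left _)

lemma integral_rieszOp {l : List ℝ} {μ : Measure ℝ} {f : ℝ → ℝ → ℝ}
    (h : ∀ γ, Integrable (fun t ↦ f t γ) μ) (γ : ℝ) :
    Integrable (fun t ↦ rieszOp l (f t) γ) μ ∧
      rieszOp l (fun γ ↦ ∫ t, f t γ ∂μ) γ = ∫ t, rieszOp l (f t) γ ∂μ := by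
  induction l generalizing γ with
  | nil => exact ⟨h γ, rfl⟩
  | cons a l ih =>
    have h1 := ((ih (γ + a)).1.const_mul (1 / 2))
    have h2 := ((ih (γ - a)).1.const_mul (1 / 2))
    refine ⟨((ih γ).1.add h1).add h2, ?_⟩
    simp only [rieszOp_cons, shiftOp]
    rw [integral_add (f := fun t ↦ rieszOp l (f t) γ + 1 / 2 * rieszOp l (f t) (γ + a))
      ((ih γ).1.add h1) h2, integral_add (ih γ).1 h1, integral_const_mul,
      integral_const_mul, (ih γ).2, (ih (γ + a)).2, (ih (γ - a)).2]

lemma rieszProd_cons (a : ℝ) (l : List ℝ) (t : ℝ) :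
    rieszProd (a :: l) t = (1 + cos (2 * π * t * a)) * rieszProd l t := by
  simp [rieszProd]

lemma rieszOp_cos (l : List ℝ) (t γ : ℝ) :
    rieszOp l (fun γ ↦ cos (2 * π * t * γ)) γ = cos (2 * π * t * γ) * rieszProd l t := by
  induction l generalizing γ with
  | nil => simp [rieszOp, rieszProd]
  | cons a l ih =>
    rw [rieszOp_cons, shiftOp, ih, ih, ih, rieszProd_cons,
      mul_add (2 * π * t), mul_sub (2 * π * t), cos_add, cos_sub]
    ring

lemma rieszProd_nonneg (l : List ℝ) (t : ℝ) : 0 ≤ rieszProd l t := by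
  refine List.prod_nonneg fun x hx ↦ ?_
  obtain ⟨a, -, rfl⟩ := List.mem_map.1 hx
  linarith [neg_one_le_cos (2 * π * t * a)]

lemma rieszProd_le (l : List ℝ) (t : ℝ) : rieszProd l t ≤ 2 ^ l.length := by
  induction l with
  | nil => simp [rieszProd]
  | cons a l ih =>
    rw [rieszProd_cons, List.length_cons, pow_succ, mul_comm]
    exact mul_le_mul ih (by linarith [cos_le_one (2 * π * t * a)])
      (by linarith [neg_one_le_cos (2 * π * t * a)]) (by positivity)

lemma integral_rpow_mul_cexp {w : ℂ} (hw : 0 < w.re) :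
    IntegrableOn (fun t : ℝ ↦ ((t ^ (-(1 / 2) : ℝ) : ℝ) : ℂ) * Complex.exp (-(w * t))) (Ioi 0) ∧
    ∫ t in Ioi (0 : ℝ), ((t ^ (-(1 / 2) : ℝ) : ℝ) : ℂ) * Complex.exp (-(w * t)) =
      (π / w) ^ (1 / 2 : ℂ) := by
  constructor
  · refine Integrable.mono (integrableOn_rpow_mul_exp_neg_mul_rpow (s := -(1 / 2)) (p := 1)
      (by norm_num) one_pos hw) (Measurable.aestronglyMeasurable (by fun_prop))
      (.of_forall fun t ↦ ?_)
    rw [norm_mul, norm_cexp_neg_mul, norm_mul, Complex.norm_real, rpow_one,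
      Real.norm_of_nonneg (exp_pos _).le]
  · have h := integral_comp_rpow_Ioi_of_pos (E := ℂ) (g := fun y : ℝ ↦ 2 * Complex.exp (-w * y ^ 2))
      (p := 1 / 2) (by norm_num)
    rw [integral_const_mul, integral_gaussian_complex_Ioi hw] at h
    rw [mul_div_cancel₀ _ (two_ne_zero)] at h
    rw [← h]
    refine setIntegral_congr_fun measurableSet_Ioi fun t ht ↦ ?_
    have ht : 0 < t := ht
    have : ((t ^ (1 / 2 : ℝ) : ℝ) : ℂ) ^ 2 = t := by
      rw [← Complex.ofReal_pow, ← sqrt_eq_rpow, sq_sqrt ht.le]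
    simp only [this]
    rw [Complex.real_smul, show (1 / 2 - 1 : ℝ) = -(1 / 2) by norm_num]
    rw [neg_mul]; push_cast
    ring

/-- The cosine transform of `t ^ (-1/2) * exp (-2πσt)`. -/
noncomputable def kfun (σ γ : ℝ) : ℝ :=
  ∫ t in Ioi (0 : ℝ), t ^ (-(1 / 2) : ℝ) * rexp (-(2 * π * σ * t)) * cos (2 * π * t * γ)

lemma re_cexp_eq (σ γ t : ℝ) : (Complex.exp (-(2 * π * (σ + γ * Complex.I) * t))).re =
    rexp (-(2 * π * σ * t)) * cos (2 * π * t * γ) := by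
  rw [Complex.exp_re]
  have : (-(2 * π * (σ + γ * Complex.I) * t) : ℂ) =
    ((-(2 * π * σ * t) : ℝ) : ℂ) + ((-(2 * π * t * γ) : ℝ) : ℂ) * Complex.I := by push_cast; ring
  rw [this]
  simp

lemma add_mul_I_re (σ γ : ℝ) : (σ + γ * Complex.I : ℂ).re = σ := by simp

lemma kfun_eq {σ : ℝ} (hσ : 0 < σ) (γ : ℝ) :
    IntegrableOn (fun t : ℝ ↦ t ^ (-(1 / 2) : ℝ) * rexp (-(2 * π * σ * t)) * cos (2 * π * t * γ))
      (Ioi 0) ∧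
    kfun σ γ = ((π / (2 * π * (σ + γ * Complex.I)) : ℂ) ^ (1 / 2 : ℂ)).re := by
  have hz : 0 < (σ + γ * Complex.I : ℂ).re := by rwa [add_mul_I_re]
  have h := integral_rpow_mul_cexp (two_pi_mul_re hz)
  have e : ∀ t : ℝ, t ^ (-(1 / 2) : ℝ) * rexp (-(2 * π * σ * t)) * cos (2 * π * t * γ) =
    (((t ^ (-(1 / 2) : ℝ) : ℝ) : ℂ) * Complex.exp (-(2 * π * (σ + γ * Complex.I) * t))).re :=
    fun t ↦ by rw [Complex.re_ofReal_mul, re_cexp_eq, mul_assoc]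
  simp_rw [kfun, e]
  exact ⟨h.1.re, by rw [← h.2]; exact (integral_re h.1)⟩

lemma kfun_nonneg {σ : ℝ} (hσ : 0 < σ) (γ : ℝ) : 0 ≤ kfun σ γ := by
  rw [(kfun_eq hσ γ).2]; exact re_cpow_half_nonneg _

lemma kfun_le {σ : ℝ} (hσ : 0 < σ) (γ : ℝ) : kfun σ γ ≤ (σ ^ 2 + γ ^ 2) ^ (-(1 / 4) : ℝ) := by
  rw [(kfun_eq hσ γ).2]
  refine (Complex.re_le_norm _).trans ?_
  have hn : ‖(σ + γ * Complex.I : ℂ)‖ ^ 2 = σ ^ 2 + γ ^ 2 := by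
    rw [← Complex.normSq_eq_norm_sq, Complex.normSq_add_mul_I]
  have hq : 0 < σ ^ 2 + γ ^ 2 := by positivity
  have hpos : 0 < ‖(σ + γ * Complex.I : ℂ)‖ :=
    norm_pos_iff.2 (ne_zero_of_re (by rwa [add_mul_I_re]))
  refine le_of_sq_le_sq ?_ (rpow_nonneg hq.le _)
  rw [norm_sq_cpow_half, ← rpow_natCast (_ ^ _), ← rpow_mul hq.le, ← hn, norm_div,
    norm_mul, norm_mul,
    Complex.norm_real, RCLike.norm_ofNat, Real.norm_of_nonneg pi_pos.le, ← rpow_natCast ‖_‖,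
    ← rpow_mul hpos.le]
  norm_num
  rw [rpow_neg_one]
  have := pi_pos
  field_simp
  norm_num

lemma le_kfun_zero {σ : ℝ} (hσ : 0 < σ) : (2 * σ) ^ (-(1 / 2) : ℝ) ≤ kfun σ 0 := by
  rw [(kfun_eq hσ 0).2]
  have h1 : (π / (2 * π * (σ + (0 : ℝ) * Complex.I)) : ℂ) = (((2 * σ)⁻¹ : ℝ) : ℂ) := by
    have : (π : ℂ) ≠ 0 := by exact_mod_cast pi_ne_zero
    push_cast
    rw [zero_mul, add_zero]
    field_simp
  have h2 : (1 / 2 : ℂ) = ((1 / 2 : ℝ) : ℂ) := by push_cast; rfl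
  rw [h1, h2, ← Complex.ofReal_cpow (by positivity), Complex.ofReal_re, inv_rpow (by positivity),
    ← rpow_neg (by positivity)]

/-- The Laplace transform of the Riesz product. -/
noncomputable def rieszInt (σ : ℝ) (l : List ℝ) : ℝ :=
  ∫ t in Ioi (0 : ℝ), t ^ (-(1 / 2) : ℝ) * rexp (-(2 * π * σ * t)) * rieszProd l t

lemma rieszInt_eq {σ : ℝ} (hσ : 0 < σ) (l : List ℝ) :
    IntegrableOn (fun t : ℝ ↦ t ^ (-(1 / 2) : ℝ) * rexp (-(2 * π * σ * t)) * rieszProd l t) (Ioi 0) ∧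
    rieszInt σ l = rieszOp l (kfun σ) 0 := by
  have h := integral_rieszOp (l := l) (fun γ ↦ (kfun_eq hσ γ).1) 0
  have e : ∀ t : ℝ, rieszOp l (fun γ ↦ t ^ (-(1 / 2) : ℝ) * rexp (-(2 * π * σ * t)) *
      cos (2 * π * t * γ)) 0 = t ^ (-(1 / 2) : ℝ) * rexp (-(2 * π * σ * t)) * rieszProd l t := fun t ↦ by
    rw [rieszOp_const_mul, rieszOp_cos]; simp
  simp_rw [e] at h
  exact ⟨h.1, h.2.symm⟩

lemma le_rieszInt {σ : ℝ} (hσ : 0 < σ) (l : List ℝ) : (2 * σ) ^ (-(1 / 2) : ℝ) ≤ rieszInt σ l := by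
  rw [(rieszInt_eq hσ l).2]
  exact (le_kfun_zero hσ).trans (le_rieszOp (kfun_nonneg hσ) 0)

lemma rieszInt_cons_le {σ : ℝ} (hσ : 0 < σ) (a : ℝ) (l : List ℝ) :
    rieszInt σ (a :: l) ≤ 2 * rieszOp l (fun γ ↦ (σ ^ 2 + γ ^ 2) ^ (-(1 / 4) : ℝ)) 0 := by
  calc rieszInt σ (a :: l) ≤ 2 * rieszInt σ l := by
        rw [rieszInt, rieszInt, ← integral_const_mul]
        refine setIntegral_mono_on (rieszInt_eq hσ _).1 (Integrable.const_mul (rieszInt_eq hσ _).1 2)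
          measurableSet_Ioi fun t ht ↦ ?_
        have ht : 0 < t := ht
        rw [rieszProd_cons]
        have h1 : 1 + cos (2 * π * t * a) ≤ 2 := by linarith [cos_le_one (2 * π * t * a)]
        have h2 := rieszProd_nonneg l t
        have h3 : 0 ≤ t ^ (-(1 / 2) : ℝ) * rexp (-(2 * π * σ * t)) := by positivity
        calc _ ≤ t ^ (-(1 / 2) : ℝ) * rexp (-(2 * π * σ * t)) * (2 * rieszProd l t) := by gcongr
          _ = _ := by ring
    _ ≤ _ := by
        rw [(rieszInt_eq hσ l).2]
        gcongr
        exact rieszOp_mono (kfun_le hσ) 0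

lemma le_rieszOp_lker {σ : ℝ} (hσ : 0 < σ) {m : ℝ} (hm : 0 < m) {l : List ℝ} (hl : √m ∈ l) :
    m ^ (1 / 4 : ℝ) / 8 * rieszInt σ l ≤ rieszOp l (fun γ ↦ (lker m (σ + γ * Complex.I)).re) 0 := by
  have hp := List.perm_cons_erase hl
  have hI : rieszInt σ l = rieszInt σ (√m :: l.erase √m) := by
    rw [(rieszInt_eq hσ _).2, (rieszInt_eq hσ _).2, rieszOp_perm hp]
  rw [rieszOp_perm hp, hI, rieszOp_cons']
  have hre : ∀ γ : ℝ, 0 ≤ (lker m (σ + γ * Complex.I)).re := fun γ ↦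
    re_lker_nonneg hm.le (by rwa [add_mul_I_re])
  have h1 := rieszInt_cons_le hσ (√m) (l.erase √m)
  have hmp : 0 < m ^ (1 / 4 : ℝ) := by positivity
  calc m ^ (1 / 4 : ℝ) / 8 * rieszInt σ (√m :: l.erase √m)
      ≤ m ^ (1 / 4 : ℝ) / 8 * (2 * rieszOp (l.erase √m)
        (fun γ ↦ (σ ^ 2 + γ ^ 2) ^ (-(1 / 4) : ℝ)) 0) := by gcongr
    _ = rieszOp (l.erase √m) (fun γ ↦ m ^ (1 / 4 : ℝ) / 4 * (σ ^ 2 + γ ^ 2) ^ (-(1 / 4) : ℝ)) 0 := by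
        rw [rieszOp_const_mul]; ring
    _ ≤ _ := by
        refine rieszOp_mono (fun γ ↦ ?_) 0
        simp only [shiftOp]
        have hs := sqrt_nonneg m
        rcases le_total 0 γ with h | h
        · have h2 : |γ + √m| = γ + √m := abs_of_nonneg (by linarith)
          have := le_re_lker hm hσ (γ := γ + √m) (by rw [h2]; linarith)
          rw [h2, add_sub_cancel_right] at this
          linarith [hre γ, hre (γ - √m)]
        · have h2 : |γ - √m| = -γ + √m := by rw [abs_of_nonpos (by linarith)]; ring
          have := le_re_lker hm hσ (γ := γ - √m) (by rw [h2]; linarith)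
          rw [h2, add_sub_cancel_right, neg_sq] at this
          linarith [hre γ, hre (γ + √m)]

lemma bfun_re_eq {σ : ℝ} (hσ : 0 < σ) (γ : ℝ) :
    IntegrableOn (fun t : ℝ ↦ latticeP (t ^ 2) * wgt t * rexp (-(2 * π * σ * t)) *
      cos (2 * π * t * γ)) (Ioi 0) ∧
    (bfun (σ + γ * Complex.I)).re = ∫ t in Ioi (0 : ℝ), latticeP (t ^ 2) * wgt t *
      rexp (-(2 * π * σ * t)) * cos (2 * π * t * γ) := by
  have hz : 0 < (σ + γ * Complex.I : ℂ).re := by rwa [add_mul_I_re]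
  have h := integrableOn_latticeP_wgt hz
  have e : ∀ t : ℝ, latticeP (t ^ 2) * wgt t * rexp (-(2 * π * σ * t)) * cos (2 * π * t * γ) =
    ((latticeP (t ^ 2) * wgt t) * Complex.exp (-(2 * π * (σ + γ * Complex.I) * t))).re :=
    fun t ↦ by rw [← Complex.ofReal_mul, Complex.re_ofReal_mul, re_cexp_eq, mul_assoc]
  simp_rw [e]
  exact ⟨h.re, (integral_re h).symm⟩

lemma abs_rieszOp_bfun_le {σ A E : ℝ} (hσ : 0 < σ) (hE : 0 ≤ E) (l : List ℝ)
    (h : ∀ t : ℝ, 0 < t → |latticeP (t ^ 2)| * wgt t * rexp (-(2 * π * σ * t)) ≤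
      A * (t ^ (-(1 / 2) : ℝ) * rexp (-(2 * π * σ * t))) + E * (1 + t ^ 2)⁻¹) :
    |rieszOp l (fun γ ↦ (bfun (σ + γ * Complex.I)).re) 0| ≤
      A * rieszInt σ l + 4 * E * 2 ^ l.length := by
  have h1 := integral_rieszOp (l := l) (fun γ ↦ (bfun_re_eq hσ γ).1) 0
  have e : ∀ t : ℝ, rieszOp l (fun γ ↦ latticeP (t ^ 2) * wgt t * rexp (-(2 * π * σ * t)) *
      cos (2 * π * t * γ)) 0 =
      latticeP (t ^ 2) * wgt t * rexp (-(2 * π * σ * t)) * rieszProd l t := fun t ↦ by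
    rw [rieszOp_const_mul, rieszOp_cos]; simp
  simp_rw [e, ← (bfun_re_eq hσ _).2] at h1
  rw [h1.2]
  have hJ := (rieszInt_eq hσ l).1
  have hK : IntegrableOn (fun t : ℝ ↦ E * 2 ^ l.length * (1 + t ^ 2)⁻¹) (Ioi 0) :=
    (Integrable.const_mul integrable_inv_one_add_sq _).integrableOn
  have hKi : ∫ t in Ioi (0 : ℝ), (1 + t ^ 2)⁻¹ ≤ 4 := by
    refine (setIntegral_le_integral integrable_inv_one_add_sq
      (.of_forall fun t ↦ by positivity)).trans ?_
    rw [integral_univ_inv_one_add_sq]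
    exact pi_lt_four.le
  calc |∫ t in Ioi (0 : ℝ), latticeP (t ^ 2) * wgt t * rexp (-(2 * π * σ * t)) * rieszProd l t|
      ≤ ∫ t in Ioi (0 : ℝ), |latticeP (t ^ 2) * wgt t * rexp (-(2 * π * σ * t)) * rieszProd l t| :=
        abs_integral_le_integral_abs
    _ ≤ ∫ t in Ioi (0 : ℝ), (A * (t ^ (-(1 / 2) : ℝ) * rexp (-(2 * π * σ * t)) * rieszProd l t) +
          E * 2 ^ l.length * (1 + t ^ 2)⁻¹) := by
        refine setIntegral_mono_on (Integrable.abs h1.1) ((Integrable.const_mul hJ A).add hK)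
          measurableSet_Ioi fun t ht ↦ ?_
        have hR := rieszProd_nonneg l t
        have hR2 := rieszProd_le l t
        rw [abs_mul, abs_mul, abs_mul, abs_of_nonneg hR, abs_of_nonneg (wgt_nonneg ht),
          abs_of_nonneg (exp_pos _).le]
        calc _ ≤ (A * (t ^ (-(1 / 2) : ℝ) * rexp (-(2 * π * σ * t))) + E * (1 + t ^ 2)⁻¹) *
              rieszProd l t := by gcongr; exact h t ht
          _ = A * (t ^ (-(1 / 2) : ℝ) * rexp (-(2 * π * σ * t)) * rieszProd l t) +
              E * rieszProd l t * (1 + t ^ 2)⁻¹ := by ring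
          _ ≤ _ := by gcongr
    _ = A * rieszInt σ l + E * 2 ^ l.length * ∫ t in Ioi (0 : ℝ), (1 + t ^ 2)⁻¹ := by
        rw [integral_add (Integrable.const_mul hJ A) hK, integral_const_mul, integral_const_mul,
          rieszInt]
    _ ≤ A * rieszInt σ l + E * 2 ^ l.length * 4 := by gcongr
    _ = _ := by ring

lemma re_lker_add_one_le {σ γ G m : ℝ} (hσ : 0 < σ) (hσ1 : σ ≤ 1) (hm : 0 < m) (hγ : |γ| ≤ G) :
    (lker m (σ + γ * Complex.I + 1)).re ≤ (2 + G) ^ 2 * m ^ (-(1 / 2) : ℝ) := by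
  have hre : (σ + γ * Complex.I + 1 : ℂ).re = σ + 1 := by simp
  have hz : 0 < (σ + γ * Complex.I + 1 : ℂ).re := by rw [hre]; linarith
  have hG : 0 ≤ G := (abs_nonneg _).trans hγ
  refine (Complex.re_le_norm _).trans (le_of_sq_le_sq ?_ (by positivity))
  refine (norm_lker_sq_le hm hz).trans ?_
  rw [mul_pow, ← rpow_natCast (m ^ _), ← rpow_mul hm.le, hre]
  norm_num
  rw [rpow_neg_one]
  have hn : ‖(σ + γ * Complex.I + 1 : ℂ)‖ ≤ 2 + G := by
    refine (norm_add_le _ _).trans ((add_le_add_left (norm_add_le _ _) _).trans ?_)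
    simp only [Complex.norm_real, norm_mul, Complex.norm_I, mul_one, norm_one, Real.norm_eq_abs]
    rw [abs_of_pos hσ]; linarith
  rw [← div_eq_mul_inv]
  refine div_le_div₀ (by positivity) ?_ hm (by nlinarith)
  calc _ ≤ (2 + G) ^ 3 := by gcongr
    _ ≤ (2 + G) ^ (2 * 2) := pow_le_pow_right₀ (by linarith) (by norm_num)
    _ = _ := by rw [pow_mul]

lemma exists_sum_rpow_le : ∃ C : ℝ, 0 < C ∧ ∀ (A E σ : ℝ) (l : List ℝ) (F : Finset (ℤ × ℤ)),
    0 ≤ A → 0 ≤ E → 0 < σ → σ ≤ 1 → (∀ a ∈ l, 0 ≤ a) → (∀ v ∈ F, v ≠ 0 ∧ √(nsq v) ∈ l) →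
    (∀ t : ℝ, 0 < t → |latticeP (t ^ 2)| * wgt t * rexp (-(2 * π * σ * t)) ≤
      A * (t ^ (-(1 / 2) : ℝ) * rexp (-(2 * π * σ * t))) + E * (1 + t ^ 2)⁻¹) →
    ∑ v ∈ F, nsq v ^ (-(3 / 4) : ℝ) ≤
      C * (A + σ ^ (1 / 2 : ℝ) * 2 ^ l.length * (E + (2 + l.sum) ^ 2)) := by
  set S := ∑' v : ℤ × ℤ, nsq v ^ (-(3 / 2) : ℝ) with hS
  have hS0 : 0 ≤ S := tsum_nonneg fun v ↦ rpow_nonneg (nsq_nonneg v) _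
  refine ⟨16 * π * 8 * (1 + S), by positivity, fun A E σ l F hA hE hσ hσ1 hl hF h ↦ ?_⟩
  set G := l.sum with hG
  have hG0 : 0 ≤ G := List.sum_nonneg hl
  set J := rieszInt σ l with hJ
  set φ : ℤ × ℤ → ℝ → ℝ := fun v γ ↦ (lker (nsq v) (σ + γ * Complex.I)).re with hφ
  set ψ : ℤ × ℤ → ℝ → ℝ := fun v γ ↦ (lker (nsq v) (σ + γ * Complex.I + 1)).re with hψ
  have hJ1 := le_rieszInt hσ l
  have hJpos : 0 < J := lt_of_lt_of_le (by positivity) hJ1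
  have hsum := hasSum_rieszOp (l := l) (φ := fun v γ ↦ if v = 0 then 0 else
      (2 * π * nsq v)⁻¹ * (ψ v γ - φ v γ)) (Φ := fun γ ↦ (bfun (σ + γ * Complex.I)).re) (fun γ ↦ by
    have hz : 0 < (σ + γ * Complex.I : ℂ).re := by rwa [add_mul_I_re]
    refine (Complex.hasSum_re (hasSum_bfun hz)).congr_fun fun v ↦ ?_
    split_ifs
    · simp
    · rw [div_eq_inv_mul, show (2 * π * nsq v : ℂ)⁻¹ = (((2 * π * nsq v)⁻¹ : ℝ) : ℂ) by push_cast; rfl,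
        Complex.re_ofReal_mul, Complex.sub_re]) 0
  have hsum2 := (hasSum_sum_of_ne_finset_zero (L := .unconditional _) (s := F)
    (f := fun v ↦ if v ∈ F then nsq v ^ (-(3 / 4) : ℝ) * (J / (16 * π)) else 0)
    (fun v hv ↦ by rw [if_neg hv])).sub
    (summable_nsq_rpow.hasSum.mul_left (2 ^ l.length * (2 + G) ^ 2))
  rw [Finset.sum_congr rfl fun v hv ↦ if_pos hv, ← Finset.sum_mul, ← hS] at hsum2
  have hle := hasSum_le (fun v ↦ by
    rcases eq_or_ne v 0 with rfl | hv
    · rw [if_neg fun h0 ↦ (hF 0 h0).1 rfl, nsq_zero, zero_rpow (by norm_num)]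
      simp only [if_true]
      have := rieszOp_const_mul l 0 (fun _ ↦ 0) 0
      rw [zero_mul] at this
      rw [this]; simp
    · have hN := one_le_nsq hv
      have hN0 : 0 < nsq v := by linarith
      simp only [hv, if_false]
      rw [rieszOp_const_mul, rieszOp_sub]
      have h1 : rieszOp l (ψ v) 0 ≤ 2 ^ l.length * ((2 + G) ^ 2 * nsq v ^ (-(1 / 2) : ℝ)) :=
        rieszOp_le hl (G := G) (fun γ hγ ↦ re_lker_add_one_le hσ hσ1 hN0 hγ)
          (by rw [abs_zero, zero_add])
      have h2 : (if v ∈ F then nsq v ^ (-(3 / 4) : ℝ) * (J / (16 * π)) else 0) ≤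
          (2 * π * nsq v)⁻¹ * rieszOp l (φ v) 0 := by
        split_ifs with hvF
        · calc nsq v ^ (-(3 / 4) : ℝ) * (J / (16 * π))
              = (2 * π * nsq v)⁻¹ * (nsq v ^ (1 / 4 : ℝ) / 8 * J) := by
                have : nsq v ^ (-(3 / 4) : ℝ) = (nsq v)⁻¹ * nsq v ^ (1 / 4 : ℝ) := by
                  rw [← rpow_neg_one, ← rpow_add hN0]; norm_num
                rw [this]; field_simp; norm_num
            _ ≤ _ := by
                gcongr
                exact le_rieszOp_lker hσ hN0 (hF v hvF).2
        · exact mul_nonneg (by positivity) (rieszOp_nonneg (fun γ ↦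
            re_lker_nonneg hN0.le (by rwa [add_mul_I_re])) _)
      have h3 : (2 * π * nsq v)⁻¹ * rieszOp l (ψ v) 0 ≤
          2 ^ l.length * (2 + G) ^ 2 * nsq v ^ (-(3 / 2) : ℝ) := by
        calc (2 * π * nsq v)⁻¹ * rieszOp l (ψ v) 0
            ≤ (2 * π * nsq v)⁻¹ * (2 ^ l.length * ((2 + G) ^ 2 * nsq v ^ (-(1 / 2) : ℝ))) := by
              gcongr
          _ ≤ (nsq v)⁻¹ * (2 ^ l.length * ((2 + G) ^ 2 * nsq v ^ (-(1 / 2) : ℝ))) := by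
              gcongr
              nlinarith [pi_gt_three]
          _ = _ := by
              have : nsq v ^ (-(3 / 2) : ℝ) = (nsq v)⁻¹ * nsq v ^ (-(1 / 2) : ℝ) := by
                rw [← rpow_neg_one, ← rpow_add hN0]; norm_num
              rw [this]; ring
      show _ ≤ -((2 * π * nsq v)⁻¹ * (rieszOp l (ψ v) 0 - rieszOp l (φ v) 0))
      linarith) hsum2 hsum.neg
  have hI := abs_rieszOp_bfun_le hσ hE l h
  have hI2 := neg_le_abs (rieszOp l (fun γ ↦ (bfun (σ + γ * Complex.I)).re) 0)
  have hcomb : (∑ v ∈ F, nsq v ^ (-(3 / 4) : ℝ)) * J ≤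
      16 * π * (A * J + 4 * E * 2 ^ l.length + 2 ^ l.length * (2 + G) ^ 2 * S) := by
    have : (∑ v ∈ F, nsq v ^ (-(3 / 4) : ℝ)) * (J / (16 * π)) ≤
      (A * J + 4 * E * 2 ^ l.length + 2 ^ l.length * (2 + G) ^ 2 * S) := by linarith
    rw [← mul_div_assoc, div_le_iff₀ (by positivity)] at this
    linarith
  have hJ2 : 1 ≤ 2 * σ ^ (1 / 2 : ℝ) * J := by
    have h2 : (2 : ℝ) ^ (1 / 2 : ℝ) ≤ 2 := by
      calc (2 : ℝ) ^ (1 / 2 : ℝ) ≤ 2 ^ (1 : ℝ) := rpow_le_rpow_of_exponent_le (by norm_num) (by norm_num)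
        _ = 2 := rpow_one 2
    calc (1 : ℝ) = (2 * σ) ^ (1 / 2 : ℝ) * (2 * σ) ^ (-(1 / 2) : ℝ) := by
          rw [← rpow_add (by positivity)]; norm_num
      _ = 2 ^ (1 / 2 : ℝ) * σ ^ (1 / 2 : ℝ) * (2 * σ) ^ (-(1 / 2) : ℝ) := by
          rw [mul_rpow (by norm_num) hσ.le]
      _ ≤ _ := by gcongr
  have hX : 0 ≤ 4 * E * 2 ^ l.length + 2 ^ l.length * (2 + G) ^ 2 * S := by positivity
  have hfin : (∑ v ∈ F, nsq v ^ (-(3 / 4) : ℝ)) * J ≤ (16 * π * (A + 2 * σ ^ (1 / 2 : ℝ) *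
      (4 * E * 2 ^ l.length + 2 ^ l.length * (2 + G) ^ 2 * S))) * J := by
    refine hcomb.trans ?_
    have := mul_le_mul_of_nonneg_left hJ2 hX
    have hpi := pi_pos
    nlinarith
  refine (le_of_mul_le_mul_right hfin hJpos).trans ?_
  rw [mul_assoc (16 * π) 8, mul_assoc (16 * π)]
  refine mul_le_mul_of_nonneg_left ?_ (by positivity)
  set Q := σ ^ (1 / 2 : ℝ) * 2 ^ l.length with hQ
  have hQ0 : 0 ≤ Q := by positivity
  have e1 : 2 * σ ^ (1 / 2 : ℝ) * (4 * E * 2 ^ l.length + 2 ^ l.length * (2 + G) ^ 2 * S) =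
    8 * (Q * E) + 2 * S * (Q * (2 + G) ^ 2) := by rw [hQ]; ring
  rw [e1]
  have p1 : 0 ≤ Q * E := by positivity
  have p2 : 0 ≤ Q * (2 + G) ^ 2 := by positivity
  nlinarith [mul_nonneg hS0 p1, mul_nonneg hS0 p2, mul_nonneg hS0 hA]

lemma gaussian_products_ne {p a b n x y x' y' : ℤ} (hp : Prime p) (h2 : ¬ p ∣ 2)
    (ha : ¬ p ∣ a) (hn : ¬ p ∣ n) (hab : a ^ 2 + b ^ 2 = p) (hv : x' ^ 2 + y' ^ 2 = n)
    (h1 : a * x - b * y = a * x' + b * y') (h3 : a * y + b * x = a * y' - b * x') : False := by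
  have key : p * ((x + x') ^ 2 + (y + y') ^ 2) = 2 * 2 * (a * a * n) := by
    have e1 : a * (x + x') - b * (y + y') = 2 * a * x' := by linarith
    have e2 : a * (y + y') + b * (x + x') = 2 * a * y' := by linarith
    have e3 : (a ^ 2 + b ^ 2) * ((x + x') ^ 2 + (y + y') ^ 2)
        = (a * (x + x') - b * (y + y')) ^ 2 + (a * (y + y') + b * (x + x')) ^ 2 := by ring
    rw [← hab, e3, e1, e2, ← hv]
    ring
  have hd : p ∣ 2 * 2 * (a * a * n) := ⟨_, key.symm⟩
  rcases hp.dvd_or_dvd hd with h | h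
  · rcases hp.dvd_or_dvd h with h | h <;> exact h2 h
  · rcases hp.dvd_or_dvd h with h | h
    · rcases hp.dvd_or_dvd h with h | h <;> exact ha h
    · exact hn h

lemma rotate_injective {a b : ℤ} (h : a ^ 2 + b ^ 2 ≠ 0) :
    Function.Injective fun v : ℤ × ℤ ↦ (a * v.1 - b * v.2, a * v.2 + b * v.1) := by
  rintro ⟨x, y⟩ ⟨x', y'⟩ hxy
  simp only [Prod.mk.injEq] at hxy ⊢
  obtain ⟨h1, h2⟩ := hxy
  constructor
  · apply mul_left_cancel₀ h
    linear_combination a * h1 + b * h2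
  · apply mul_left_cancel₀ h
    linear_combination a * h2 - b * h1

/-- A product of `k` distinct primes congruent to `1` mod `4` has at least `2 ^ k`
representations as a sum of two squares. -/
lemma exists_finset_sq_add_sq (S : Finset ℕ) (hS : ∀ p ∈ S, p.Prime ∧ p % 4 = 1) :
    ∃ T : Finset (ℤ × ℤ), 2 ^ S.card ≤ T.card ∧
      ∀ v ∈ T, v.1 ^ 2 + v.2 ^ 2 = ((∏ p ∈ S, p : ℕ) : ℤ) := by
  classical
  induction S using Finset.induction_on with
  | empty => exact ⟨{(1, 0)}, by simp, by simp⟩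
  | insert p S hpS ih =>
    obtain ⟨T, hT, hTv⟩ := ih fun q hq ↦ hS q (Finset.mem_insert_of_mem hq)
    obtain ⟨hp, hp4⟩ := hS p (Finset.mem_insert_self p S)
    have : Fact p.Prime := ⟨hp⟩
    obtain ⟨a, b, hab⟩ := Nat.Prime.sq_add_sq (p := p) (by omega)
    have habz : (a : ℤ) ^ 2 + (b : ℤ) ^ 2 = p := by exact_mod_cast hab
    have hpn : ¬ (p : ℤ) ∣ ((∏ q ∈ S, q : ℕ) : ℤ) := by
      intro h
      have h' := Int.natCast_dvd_natCast.mp h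
      obtain ⟨q, hq, hpq⟩ := (hp.prime.dvd_finsetProd_iff _).mp h'
      have := (Nat.prime_dvd_prime_iff_eq hp (hS q (Finset.mem_insert_of_mem hq)).1).mp hpq
      exact hpS (this ▸ hq)
    have hpz : Prime (p : ℤ) := Nat.prime_iff_prime_int.mp hp
    have hp2 : ¬ (p : ℤ) ∣ 2 := by
      intro h
      have h' : p ∣ 2 := by exact_mod_cast h
      have := Nat.le_of_dvd (by norm_num) h'
      have := hp.two_le
      omega
    have hpa : ¬ (p : ℤ) ∣ a := by
      intro h
      have h' : p ∣ a := by exact_mod_cast h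
      rcases Nat.eq_zero_or_pos a with h0 | h0
      · subst h0
        have hb : p = b * b := by rw [← hab]; ring
        exact (Nat.Prime.prime hp).irreducible.not_isSquare ⟨b, hb⟩
      · have := Nat.le_of_dvd h0 h'
        have := hp.two_le
        nlinarith [Nat.zero_le (b ^ 2)]
    have hp0 : (p : ℤ) ≠ 0 := by exact_mod_cast hp.ne_zero
    have hf := rotate_injective (a := a) (b := b) (habz ▸ hp0)
    have hg := rotate_injective (a := a) (b := -b) (by rw [neg_sq]; exact habz ▸ hp0)
    refine ⟨T.image (fun v : ℤ × ℤ ↦ (a * v.1 - b * v.2, a * v.2 + b * v.1)) ∪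
      T.image (fun v : ℤ × ℤ ↦ (a * v.1 - (-b) * v.2, a * v.2 + (-b) * v.1)), ?_, ?_⟩
    · rw [Finset.card_union_of_disjoint, Finset.card_image_of_injective _ hf,
        Finset.card_image_of_injective _ hg, Finset.card_insert_of_notMem hpS, pow_succ]
      · omega
      · rw [Finset.disjoint_left]
        intro z hz hz'
        simp only [Finset.mem_image] at hz hz'
        obtain ⟨v, -, rfl⟩ := hz
        obtain ⟨w, hw, hvw⟩ := hz'
        simp only [Prod.mk.injEq] at hvw
        refine gaussian_products_ne hpz hp2 hpa hpn habz (hTv w hw) (x := v.1) (y := v.2) ?_ ?_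
        · linarith [hvw.1]
        · linarith [hvw.2]
    · intro v hv
      rw [Finset.prod_insert hpS, Nat.cast_mul, ← habz]
      rcases Finset.mem_union.mp hv with h | h <;> obtain ⟨w, hw, rfl⟩ := Finset.mem_image.mp h <;>
        (rw [← hTv w hw]; ring)

lemma exists_sum_two_pow_mul_le : ∃ C : ℝ, 0 < C ∧ ∀ (A E σ : ℝ) (𝒮 : Finset (Finset ℕ)),
    0 ≤ A → 0 ≤ E → 0 < σ → σ ≤ 1 → (∀ S ∈ 𝒮, ∀ p ∈ S, p.Prime ∧ p % 4 = 1) →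
    (∀ t : ℝ, 0 < t → |latticeP (t ^ 2)| * wgt t * rexp (-(2 * π * σ * t))
      ≤ A * (t ^ (-(1 / 2) : ℝ) * rexp (-(2 * π * σ * t))) + E * (1 + t ^ 2)⁻¹) →
    ∑ S ∈ 𝒮, 2 ^ S.card * ((∏ p ∈ S, p : ℕ) : ℝ) ^ (-(3 / 4) : ℝ)
      ≤ C * (A + σ ^ (1 / 2 : ℝ) * 2 ^ 𝒮.card
        * (E + (2 + ∑ S ∈ 𝒮, √((∏ p ∈ S, p : ℕ) : ℝ)) ^ 2)) := by
  classical
  obtain ⟨C, hC, hmain⟩ := exists_sum_rpow_le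
  refine ⟨C, hC, fun A E σ 𝒮 hA hE hσ hσ1 hS hP ↦ ?_⟩
  have hex : ∀ S : Finset ℕ, ∃ T : Finset (ℤ × ℤ), S ∈ 𝒮 → 2 ^ S.card ≤ T.card ∧
      ∀ v ∈ T, v.1 ^ 2 + v.2 ^ 2 = ((∏ p ∈ S, p : ℕ) : ℤ) := by
    intro S
    by_cases h : S ∈ 𝒮
    · obtain ⟨T, hT⟩ := exists_finset_sq_add_sq S (hS S h)
      exact ⟨T, fun _ ↦ hT⟩
    · exact ⟨∅, fun h' ↦ absurd h' h⟩
  choose T hT using hex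
  have hnsq : ∀ S ∈ 𝒮, ∀ v ∈ T S, nsq v = ((∏ p ∈ S, p : ℕ) : ℝ) := by
    intro S h v hv
    have := (hT S h).2 v hv
    unfold nsq
    exact_mod_cast this
  have hdisj : Set.PairwiseDisjoint (𝒮 : Set (Finset ℕ)) T := by
    intro S h S' h' hne
    rw [Function.onFun, Finset.disjoint_left]
    intro v hv hv'
    apply hne
    have e := (hnsq S h v hv).symm.trans (hnsq S' h' v hv')
    have e' : ∏ p ∈ S, p = ∏ p ∈ S', p := by exact_mod_cast e
    rw [← Nat.primeFactors_prod fun p hp ↦ (hS S h p hp).1, e',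
      Nat.primeFactors_prod fun p hp ↦ (hS S' h' p hp).1]
  have key := hmain A E σ (𝒮.toList.map fun S ↦ √((∏ p ∈ S, p : ℕ) : ℝ)) (𝒮.biUnion T)
    hA hE hσ hσ1 ?_ ?_ hP
  · rw [Finset.sum_biUnion hdisj, List.length_map, Finset.length_toList, Finset.sum_map_toList]
      at key
    refine le_trans (Finset.sum_le_sum fun S h ↦ ?_) key
    rw [Finset.sum_congr rfl fun v hv ↦ by rw [hnsq S h v hv], Finset.sum_const, nsmul_eq_mul]
    gcongr
    exact_mod_cast (hT S h).1
  · intro x hx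
    obtain ⟨S, -, rfl⟩ := List.mem_map.mp hx
    positivity
  · intro v hv
    obtain ⟨S, h, hv⟩ := Finset.mem_biUnion.mp hv
    refine ⟨?_, ?_⟩
    · rintro rfl
      have h0 := hnsq S h 0 hv
      rw [nsq_zero] at h0
      have h1 : 0 < ∏ p ∈ S, p := Finset.prod_pos fun p hp ↦ (hS S h p hp).1.pos
      have : (0 : ℝ) < ((∏ p ∈ S, p : ℕ) : ℝ) := by exact_mod_cast h1
      exact absurd h0 this.ne
    · rw [hnsq S h v hv]
      exact List.mem_map.mpr ⟨S, Finset.mem_toList.mpr h, rfl⟩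

open ArithmeticFunction.vonMangoldt in
/-- Quantitative divergence of `∑ 1 / p` over the primes congruent to `1` mod `4`. -/
lemma exists_primes_sum_rpow_ge : ∃ C : ℝ, ∀ δ : ℝ, 0 < δ → δ ≤ 1 →
    ∃ Q : Finset ℕ, (∀ p ∈ Q, p.Prime ∧ p % 4 = 1) ∧
      1 / 2 * log (1 / δ) - C ≤ ∑ p ∈ Q, (p : ℝ) ^ (-(1 + δ)) := by
  let a : ZMod 4 := 1
  let rp : ℕ → ℝ := fun n ↦ if n.Prime then residueClass a n else 0
  let rn : ℕ → ℝ := fun n ↦ if n.Prime then 0 else residueClass a n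
  obtain ⟨C, hC⟩ := LSeries_residueClass_lower_bound (q := 4) (a := a) isUnit_one
  have hrn := summable_residueClass_non_primes_div (q := 4) a
  have hsumm : ∀ x : ℝ, 1 < x → Summable fun n : ℕ ↦ residueClass a n / (n : ℝ) ^ x :=
    fun x hx ↦ LSeries.summable_real_of_abscissaOfAbsConv_lt <|
      (abscissaOfAbsConv_residueClass_le_one a).trans_lt <| mod_cast hx
  have hr0 : ∀ n, 0 ≤ residueClass a n := residueClass_nonneg a
  have hpsumm : ∀ x : ℝ, 1 < x → Summable fun n : ℕ ↦ rp n / (n : ℝ) ^ x := by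
    intro x hx
    refine (hsumm x hx).of_nonneg_of_le (fun n ↦ ?_) (fun n ↦ ?_)
    · simp only [rp]; split_ifs <;> have := hr0 n <;> positivity
    · simp only [rp]; gcongr; split_ifs
      · exact le_rfl
      · exact hr0 n
  set C1 : ℝ := ∑' n : ℕ, (if n.Prime then 0 else residueClass a n) / (n : ℝ) with hC1
  have hlow : ∀ x : ℝ, 1 < x → x ≤ 2 →
      1 / 2 / (x - 1) - C - C1 ≤ ∑' n, rp n / (n : ℝ) ^ x := by
    intro x hx hx2
    have h1 := hC (x := x) ⟨hx, hx2⟩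
    have ht : (Nat.totient 4 : ℝ) = 2 := by
      have : Nat.totient 4 = 2 := by decide
      rw [this]; norm_num
    rw [ht] at h1
    have h2 : ∑' n, residueClass a n / (n : ℝ) ^ x ≤ ∑' n, (rp n / (n : ℝ) ^ x +
        (if n.Prime then 0 else residueClass a n) / (n : ℝ)) := by
      refine (hsumm x hx).tsum_le_tsum (fun n ↦ ?_) ((hpsumm x hx).add hrn)
      simp only [rp]
      split_ifs with h
      · simp
      · rcases n.eq_zero_or_pos with rfl | hn
        · simp
        · rw [zero_div, zero_add]
          refine div_le_div_of_nonneg_left (hr0 n) (mod_cast hn) ?_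
          conv_lhs => rw [← Real.rpow_one n]
          exact Real.rpow_le_rpow_of_exponent_le (by exact_mod_cast hn) hx.le
    rw [(hpsumm x hx).tsum_add hrn] at h2
    rw [one_div]
    linarith
  refine ⟨|C + C1 + 1|, fun δ hδ hδ1 ↦ ?_⟩
  have hδ' : 1 < 1 + δ := by linarith
  obtain ⟨s, hs⟩ := ((hpsumm _ hδ').hasSum.eventually_const_lt
    (sub_one_lt (∑' n, rp n / (n : ℝ) ^ (1 + δ)))).exists
  have hlow' : ∀ x : ℝ, 1 + δ ≤ x → x ≤ 2 →
      1 / 2 / (x - 1) - |C + C1 + 1| ≤ ∑ n ∈ s, rp n / (n : ℝ) ^ x := by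
    intro x hx hx2
    have h1 := hlow x (by linarith) hx2
    have hsx := hpsumm x (by linarith)
    have h2 := ((hpsumm _ hδ').sub hsx).sum_le_tsum s (fun n _ ↦ by
      rw [sub_nonneg]
      simp only [rp]
      split_ifs with h
      · refine div_le_div_of_nonneg_left (hr0 n) ?_ ?_
        · have : (0 : ℝ) < n := mod_cast h.pos
          positivity
        · exact Real.rpow_le_rpow_of_exponent_le (by exact_mod_cast h.pos) hx
      · simp)
    rw [(hpsumm _ hδ').tsum_sub hsx, Finset.sum_sub_distrib] at h2
    have := le_abs_self (C + C1 + 1)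
    linarith
  set Q := s.filter fun p ↦ p.Prime ∧ p % 4 = 1 with hQ
  have hrp : ∀ x : ℝ, ∑ n ∈ s, rp n / (n : ℝ) ^ x = ∑ p ∈ Q, log p * (p : ℝ) ^ (-x) := by
    intro x
    rw [hQ, Finset.sum_filter]
    refine Finset.sum_congr rfl fun n _ ↦ ?_
    by_cases hn : n.Prime
    · have hm : (n : ZMod 4) = a ↔ n % 4 = 1 := by
        rw [show a = ((1 : ℕ) : ZMod 4) by simp [a], ZMod.natCast_eq_natCast_iff']
      by_cases h4 : n % 4 = 1
      · rw [if_pos ⟨hn, h4⟩, rpow_neg n.cast_nonneg, div_eq_mul_inv]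
        congr 1
        simp only [rp, if_pos hn, residueClass]
        rw [Set.indicator_of_mem (by exact hm.mpr h4)]
        exact ArithmeticFunction.vonMangoldt_apply_prime hn
      · rw [if_neg (fun h ↦ h4 h.2)]
        simp only [rp, if_pos hn, residueClass]
        rw [Set.indicator_of_notMem (by exact fun h ↦ h4 (hm.mp h)), zero_div]
    · rw [if_neg (fun h ↦ hn h.1)]
      simp [rp, hn]
  refine ⟨Q, fun p hp ↦ (Finset.mem_filter.mp hp).2, ?_⟩
  set K := |C + C1 + 1|
  have hpos : ∀ p ∈ Q, (0 : ℝ) < p := fun p hp ↦ mod_cast (Finset.mem_filter.mp hp).2.1.pos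
  have hderiv : ∀ x : ℝ, 1 < x → HasDerivAt
      (fun x : ℝ ↦ ∑ p ∈ Q, (p : ℝ) ^ (-x) + 1 / 2 * log (x - 1) - K * x)
      (∑ p ∈ Q, (log p * (-1) * (p : ℝ) ^ (-x)) + 1 / 2 * (1 / (x - 1)) - K * 1) x := by
    intro x hx
    refine ((HasDerivAt.fun_sum fun p hp ↦ ?_).add ?_).sub ((hasDerivAt_id x).const_mul K)
    · exact (hasDerivAt_neg x).const_rpow (hpos p hp)
    · exact (((hasDerivAt_id x).sub_const 1).log (by simp; linarith)).const_mul _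
  have hanti : AntitoneOn
      (fun x : ℝ ↦ ∑ p ∈ Q, (p : ℝ) ^ (-x) + 1 / 2 * log (x - 1) - K * x) (Icc (1 + δ) 2) := by
    refine antitoneOn_of_hasDerivWithinAt_nonpos (convex_Icc _ _)
      (fun x hx ↦ (hderiv x (by linarith [hx.1])).continuousAt.continuousWithinAt)
      (fun x hx ↦ ((hderiv x ?_)).hasDerivWithinAt) (fun x hx ↦ ?_)
    · rw [interior_Icc] at hx; linarith [hx.1]
    · rw [interior_Icc] at hx
      have h1 := hlow' x hx.1.le hx.2.le
      rw [hrp] at h1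
      simp only [mul_neg_one, neg_mul, Finset.sum_neg_distrib]
      have : 1 / 2 / (x - 1) = 1 / 2 * (1 / (x - 1)) := by ring
      linarith
  have h := hanti (left_mem_Icc.mpr (by linarith)) (right_mem_Icc.mpr (by linarith))
    (by linarith : 1 + δ ≤ 2)
  simp only [add_sub_cancel_left] at h
  have h0 : 0 ≤ ∑ p ∈ Q, (p : ℝ) ^ (-(2 : ℝ)) := Finset.sum_nonneg fun p _ ↦ by positivity
  have hK : 0 ≤ K := abs_nonneg _
  norm_num at h
  rw [one_div δ, log_inv]
  have hKδ := mul_nonneg hK hδ.le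
  norm_num at h0
  simp only [neg_add_rev] at *
  linarith

/-- For a set `S` of `k` primes congruent to `1` mod `4`, a lower bound for the contribution
`r(n) n ^ (-3 / 4)` of `n = ∏ p ∈ S, p`. -/
noncomputable def repWeight (S : Finset ℕ) : ℝ :=
  2 ^ S.card * ((∏ p ∈ S, p : ℕ) : ℝ) ^ (-(3 / 4) : ℝ)

lemma one_le_prod_primes {S : Finset ℕ} (hS : ∀ p ∈ S, p.Prime ∧ p % 4 = 1) :
    (1 : ℝ) ≤ ((∏ p ∈ S, p : ℕ) : ℝ) := by
  exact_mod_cast Finset.prod_pos fun p hp ↦ (hS p hp).1.pos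

lemma repWeight_pos {S : Finset ℕ} (hS : ∀ p ∈ S, p.Prime ∧ p % 4 = 1) : 0 < repWeight S := by
  have := one_le_prod_primes hS
  unfold repWeight
  positivity

lemma repWeight_le {S : Finset ℕ} (hS : ∀ p ∈ S, p.Prime ∧ p % 4 = 1) :
    repWeight S ≤ ((∏ p ∈ S, p : ℕ) : ℝ) ^ (-(1 / 4) : ℝ) := by
  have h1 := one_le_prod_primes hS
  have h4 : (4 : ℝ) ^ S.card ≤ ((∏ p ∈ S, p : ℕ) : ℝ) := by
    have : 4 ^ S.card ≤ ∏ p ∈ S, p := Finset.pow_card_le_prod S _ _ fun p hp ↦ by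
      have := (hS p hp).1.two_le
      have := (hS p hp).2
      omega
    exact_mod_cast this
  have h2 : (2 : ℝ) ^ S.card ≤ ((∏ p ∈ S, p : ℕ) : ℝ) ^ (1 / 2 : ℝ) := by
    rw [← Real.sqrt_eq_rpow]
    apply Real.le_sqrt_of_sq_le
    rw [← pow_mul, mul_comm, pow_mul]
    convert! h4 using 2
    norm_num
  unfold repWeight
  calc _ ≤ ((∏ p ∈ S, p : ℕ) : ℝ) ^ (1 / 2 : ℝ) * ((∏ p ∈ S, p : ℕ) : ℝ) ^ (-(3 / 4) : ℝ) := by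
        gcongr
    _ = _ := by
        rw [← rpow_add (by linarith)]
        norm_num

lemma exp_sub_sq_le {x : ℝ} (hx : 0 ≤ x) : rexp (x - x ^ 2) ≤ 1 + x := by
  rw [← Real.le_log_iff_exp_le (by linarith)]
  refine le_trans ?_ (Real.one_sub_inv_le_log_of_pos (by linarith))
  rw [show 1 - (1 + x)⁻¹ = x / (1 + x) by field_simp; ring, le_div_iff₀ (by linarith)]
  nlinarith [pow_nonneg hx 3]

lemma exists_sum_repWeight_rpow_ge : ∃ c : ℝ, 0 < c ∧ ∀ δ : ℝ, 0 < δ → δ ≤ 1 →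
    ∃ Q : Finset ℕ, (∀ p ∈ Q, p.Prime ∧ p % 4 = 1) ∧
      c * (1 / δ) ^ ((2 : ℝ) ^ (1 / 3 : ℝ)) ≤
        ∑ S ∈ Q.powerset, repWeight S ^ (4 / 3 * (1 + δ)) := by
  obtain ⟨C, hC⟩ := exists_primes_sum_rpow_ge
  set κ : ℝ := 2 ^ (4 / 3 : ℝ) with hκ
  have hκ0 : 0 < κ := by positivity
  have hκ2 : κ * (1 / 2) = 2 ^ (1 / 3 : ℝ) := by
    rw [hκ, show (4 / 3 : ℝ) = 1 / 3 + 1 by norm_num, rpow_add_one (by norm_num)]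
    ring
  set Z : ℝ := ∑' n : ℕ, 1 / (n : ℝ) ^ 2 with hZ
  have hZs : Summable fun n : ℕ ↦ 1 / (n : ℝ) ^ 2 := Real.summable_one_div_nat_pow.mpr one_lt_two
  refine ⟨rexp (-(κ * C) - κ ^ 2 * Z), exp_pos _, fun δ hδ hδ1 ↦ ?_⟩
  obtain ⟨Q, hQ, hsum⟩ := hC δ hδ hδ1
  refine ⟨Q, hQ, ?_⟩
  have hx : ∀ p ∈ Q, 0 ≤ κ * (p : ℝ) ^ (-(1 + δ)) := fun p _ ↦ by positivity
  have hsq : ∑ p ∈ Q, (κ * (p : ℝ) ^ (-(1 + δ))) ^ 2 ≤ κ ^ 2 * Z := by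
    simp_rw [mul_pow]
    rw [← Finset.mul_sum]
    gcongr
    refine le_trans (Finset.sum_le_sum fun p hp ↦ ?_)
      (hZs.sum_le_tsum Q fun n _ ↦ by positivity)
    have h1 : (1 : ℝ) ≤ p := mod_cast (hQ p hp).1.one_le
    rw [rpow_neg (by linarith), inv_pow, one_div]
    gcongr
    conv_lhs => rw [← rpow_one (p : ℝ)]
    exact rpow_le_rpow_of_exponent_le h1 (by linarith)
  calc _ = rexp (κ * (1 / 2 * log (1 / δ) - C) - κ ^ 2 * Z) := by
        rw [rpow_def_of_pos (by positivity), ← exp_add, ← hκ2]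
        ring_nf
    _ ≤ rexp (∑ p ∈ Q, (κ * (p : ℝ) ^ (-(1 + δ)) - (κ * (p : ℝ) ^ (-(1 + δ))) ^ 2)) := by
        rw [Finset.sum_sub_distrib, ← Finset.mul_sum]
        gcongr
    _ = ∏ p ∈ Q, rexp (κ * (p : ℝ) ^ (-(1 + δ)) - (κ * (p : ℝ) ^ (-(1 + δ))) ^ 2) := exp_sum _ _
    _ ≤ ∏ p ∈ Q, (1 + κ * (p : ℝ) ^ (-(1 + δ))) :=
        Finset.prod_le_prod (fun p _ ↦ (exp_pos _).le) fun p hp ↦ exp_sub_sq_le (hx p hp)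
    _ = ∑ S ∈ Q.powerset, ∏ p ∈ S, (κ * (p : ℝ) ^ (-(1 + δ))) := Finset.prod_one_add Q
    _ ≤ _ := Finset.sum_le_sum fun S hS ↦ ?_
  have hS' := fun p hp ↦ hQ p (Finset.mem_powerset.mp hS hp)
  have h1 := one_le_prod_primes hS'
  rw [Finset.prod_mul_distrib, Finset.prod_const,
    Real.finsetProd_rpow _ _ (fun p _ ↦ p.cast_nonneg), ← Nat.cast_prod, repWeight,
    mul_rpow (by positivity) (by positivity), ← rpow_mul (by positivity)]
  gcongr ?_ * ?_
  · rw [rpow_mul (by positivity), ← rpow_pow_comm (by norm_num)]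
    conv_lhs => rw [← rpow_one (κ ^ S.card)]
    refine rpow_le_rpow_of_exponent_le (one_le_pow₀ ?_) (by linarith)
    exact one_le_rpow (by norm_num) (by norm_num)
  · exact (congrArg _ (by ring)).le

lemma one_add_sq_sq_mul_exp_le {σ t : ℝ} (hσ : 0 < σ) (ht : 1 ≤ t) (h : 1 ≤ σ ^ 2 * t) :
    (1 + t ^ 2) ^ 2 * rexp (-(2 * π * σ * t)) ≤ 161280 := by
  have hu : 0 ≤ 2 * π * σ * t := by positivity
  have h1 := Real.pow_div_factorial_le_exp _ hu 8
  have h2 : t ^ 4 ≤ (2 * π * σ * t) ^ 8 := by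
    have h3 : t ≤ (σ * t) ^ 2 := by nlinarith
    have h4 : σ * t ≤ 2 * π * σ * t := by
      have : 0 < σ * t := by positivity
      nlinarith [pi_gt_three]
    calc t ^ 4 ≤ ((σ * t) ^ 2) ^ 4 := by gcongr
      _ = (σ * t) ^ 8 := by ring
      _ ≤ _ := by gcongr
  have h5 : (1 + t ^ 2) ^ 2 ≤ 4 * t ^ 4 := by nlinarith [one_le_pow₀ ht (n := 2)]
  have h6 : ((Nat.factorial 8 : ℕ) : ℝ) = 40320 := by norm_num [Nat.factorial]
  rw [h6, div_le_iff₀ (by norm_num)] at h1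
  rw [Real.exp_neg, ← div_eq_mul_inv, div_le_iff₀ (exp_pos _)]
  linarith

lemma abs_latticeP_mul_wgt_le {θ η : ℝ} (hθ : 0 ≤ θ) (hη : 0 ≤ η) {t₀ : ℝ}
    (hP : ∀ t ≥ t₀, |latticeP (t ^ 2)| ≤
      η * (t ^ (1 / 2 : ℝ) * (2 * log t) ^ (1 / 4 : ℝ) * log (2 * log t) ^ θ)) :
    ∃ E : ℝ, 0 ≤ E ∧ ∀ σ D : ℝ, 0 < σ → σ = rexp (-D) → 1 ≤ D → ∀ t : ℝ, 0 < t →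
      |latticeP (t ^ 2)| * wgt t * rexp (-(2 * π * σ * t)) ≤
        η * ((4 * D) ^ (1 / 4 : ℝ) * log (4 * D) ^ θ) *
          (t ^ (-(1 / 2) : ℝ) * rexp (-(2 * π * σ * t))) + E * (1 + t ^ 2)⁻¹ := by
  set T := max t₀ 3 with hT
  have hE : 0 ≤ 18 * π * ((1 + T ^ 2) ^ 2 + 161280) := by positivity
  refine ⟨18 * π * ((1 + T ^ 2) ^ 2 + 161280), hE, ?_⟩
  intro σ D hσ hσD hD t ht
  have hw0 := wgt_nonneg ht
  have hlogD : 0 ≤ log (4 * D) := log_nonneg (by linarith)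
  have hA : 0 ≤ η * ((4 * D) ^ (1 / 4 : ℝ) * log (4 * D) ^ θ) *
      (t ^ (-(1 / 2) : ℝ) * rexp (-(2 * π * σ * t))) := by positivity
  have hcrude : |latticeP (t ^ 2)| * wgt t * rexp (-(2 * π * σ * t)) ≤
      18 * π * ((1 + t ^ 2) ^ 2 * rexp (-(2 * π * σ * t))) * (1 + t ^ 2)⁻¹ := by
    calc _ ≤ (9 * (1 + t ^ 2)) * (2 * π) * rexp (-(2 * π * σ * t)) := by
          gcongr
          · exact abs_latticeP_le (sq_nonneg t)
          · exact wgt_le ht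
      _ = _ := by field_simp; ring
  have hcase : (1 + t ^ 2) ^ 2 * rexp (-(2 * π * σ * t)) ≤ (1 + T ^ 2) ^ 2 + 161280 →
      |latticeP (t ^ 2)| * wgt t * rexp (-(2 * π * σ * t)) ≤
        η * ((4 * D) ^ (1 / 4 : ℝ) * log (4 * D) ^ θ) *
          (t ^ (-(1 / 2) : ℝ) * rexp (-(2 * π * σ * t))) +
          18 * π * ((1 + T ^ 2) ^ 2 + 161280) * (1 + t ^ 2)⁻¹ := by
    intro h
    refine (hcrude.trans ?_).trans (le_add_of_nonneg_left hA)
    gcongr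
  rcases le_total t T with htT | htT
  · apply hcase
    have h1 : rexp (-(2 * π * σ * t)) ≤ 1 := Real.exp_le_one_iff.mpr (by
      have : 0 ≤ 2 * π * σ * t := by positivity
      linarith)
    calc (1 + t ^ 2) ^ 2 * rexp (-(2 * π * σ * t)) ≤ (1 + T ^ 2) ^ 2 * 1 := by gcongr
      _ ≤ _ := by linarith
  rcases le_total 1 (σ ^ 2 * t) with hσt | hσt
  · apply hcase
    have ht3 : 3 ≤ t := (le_max_right _ _).trans htT
    have := one_add_sq_sq_mul_exp_le hσ (by linarith) hσt
    have : 0 ≤ (1 + T ^ 2) ^ 2 := by positivity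
    linarith
  · have ht3 : 3 ≤ t := (le_max_right _ _).trans htT
    have hlogt : 1 ≤ log t := by
      rw [Real.le_log_iff_exp_le ht]
      linarith [Real.exp_one_lt_d9]
    have hlog : log t ≤ 2 * D := by
      have h1 := Real.log_le_log (by positivity) hσt
      rw [log_mul (by positivity) ht.ne', log_pow, hσD, log_exp, log_one] at h1
      push_cast at h1
      linarith
    refine le_trans ?_ (le_add_of_nonneg_right (by positivity))
    have hll : 0 ≤ log (2 * log t) := log_nonneg (by linarith)
    have h1 := hP t ((le_max_left _ _).trans htT)
    calc |latticeP (t ^ 2)| * wgt t * rexp (-(2 * π * σ * t))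
        ≤ (η * (t ^ (1 / 2 : ℝ) * (4 * D) ^ (1 / 4 : ℝ) * log (4 * D) ^ θ)) * (1 / t) *
          rexp (-(2 * π * σ * t)) := by
          gcongr
          · refine h1.trans ?_
            have h2 : 2 * log t ≤ 4 * D := by linarith
            have h3 := Real.log_le_log (by linarith) h2
            gcongr
          · exact wgt_le_inv ht
      _ = _ := by
          have : t ^ (-(1 / 2) : ℝ) = t ^ (1 / 2 : ℝ) * (1 / t) := by
            rw [show (-(1 / 2) : ℝ) = 1 / 2 - 1 by norm_num, rpow_sub_one ht.ne']
            ring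
          rw [this]
          ring

lemma sqrt_prod_le {S : Finset ℕ} (hS : ∀ p ∈ S, p.Prime ∧ p % 4 = 1) {m : ℕ}
    (h : (1 / 2 : ℝ) ^ m ≤ repWeight S) : √((∏ p ∈ S, p : ℕ) : ℝ) ≤ 4 ^ m := by
  have h1 := one_le_prod_primes hS
  have h2 := h.trans (repWeight_le hS)
  set N := ((∏ p ∈ S, p : ℕ) : ℝ)
  rw [rpow_neg (by linarith), one_div, inv_pow,
    inv_le_inv₀ (by positivity) (rpow_pos_of_pos (by linarith) _)] at h2
  have h3 : N = (N ^ (1 / 4 : ℝ)) ^ 4 := by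
    rw [← rpow_natCast, ← rpow_mul (by linarith)]
    norm_num
  apply Real.sqrt_le_iff.mpr ⟨by positivity, ?_⟩
  rw [h3]
  calc (N ^ (1 / 4 : ℝ)) ^ 4 ≤ (2 ^ m) ^ 4 := by gcongr
    _ = (4 ^ m) ^ 2 := by
        rw [← pow_mul, ← pow_mul, show (4 : ℝ) = 2 ^ 2 by norm_num, ← pow_mul]
        ring_nf

lemma exists_card_le {θ : ℝ} (hθ : 0 ≤ θ)
    (hP : ∀ η : ℝ, 0 < η → ∃ t₀ : ℝ, ∀ t ≥ t₀, |latticeP (t ^ 2)| ≤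
      η * (t ^ (1 / 2 : ℝ) * (2 * log t) ^ (1 / 4 : ℝ) * log (2 * log t) ^ θ)) :
    ∃ C : ℝ, 0 < C ∧ ∀ η : ℝ, 0 < η → ∃ E : ℝ, 0 ≤ E ∧ ∀ (m : ℕ) (F : Finset (Finset ℕ)),
      1 ≤ m → (∀ S ∈ F, ∀ p ∈ S, p.Prime ∧ p % 4 = 1) → (∀ S ∈ F, (1 / 2 : ℝ) ^ m ≤ repWeight S) →
      (F.card : ℝ) ≤ 2 ^ m * (C * (η * ((48 * ((F.card : ℝ) + m)) ^ (1 / 4 : ℝ) *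
        log (48 * ((F.card : ℝ) + m)) ^ θ) + E)) := by
  obtain ⟨C, hC, hmain⟩ := exists_sum_two_pow_mul_le
  refine ⟨C, hC, fun η hη ↦ ?_⟩
  obtain ⟨t₀, ht₀⟩ := hP η hη
  obtain ⟨E, hE, hEb⟩ := abs_latticeP_mul_wgt_le hθ hη.le ht₀
  refine ⟨E + 1, by linarith, fun m F hm hF hFm ↦ ?_⟩
  set k : ℝ := (F.card : ℝ) with hk
  have hk0 : 0 ≤ k := Nat.cast_nonneg _
  have hm1 : (1 : ℝ) ≤ m := by exact_mod_cast hm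
  set Γ := ∑ S ∈ F, √((∏ p ∈ S, p : ℕ) : ℝ) with hΓ
  have hΓ0 : 0 ≤ Γ := Finset.sum_nonneg fun S _ ↦ Real.sqrt_nonneg _
  have hΓk : Γ ≤ k * 4 ^ m := by
    rw [hk, ← nsmul_eq_mul]
    exact Finset.sum_le_card_nsmul _ _ _ fun S hS ↦ sqrt_prod_le (hF S hS) (hFm S hS)
  set B : ℝ := 2 ^ F.card * (2 + Γ) ^ 2 with hB
  have h2k : (1 : ℝ) ≤ 2 ^ F.card := one_le_pow₀ (by norm_num)
  have hB4 : 4 ≤ B := by nlinarith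
  set D := 2 * log B with hD
  have hlogB : 1 ≤ log B := by
    rw [Real.le_log_iff_exp_le (by linarith)]
    linarith [Real.exp_one_lt_d9]
  have hlog2 := Real.log_two_lt_d9
  have hDle : 4 * D ≤ 48 * (k + m) := by
    have h1 : log B = k * log 2 + 2 * log (2 + Γ) := by
      rw [hB, log_mul (by positivity) (by positivity), log_pow, log_pow]
      norm_num [hk]
    have h2 : log (2 + Γ) ≤ log (2 + k) + m * log 4 := by
      rw [← log_pow, ← log_mul (by positivity) (by positivity)]
      apply Real.log_le_log (by positivity)
      have : (1 : ℝ) ≤ 4 ^ m := one_le_pow₀ (by norm_num)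
      linarith
    have h3 : log (2 + k) ≤ 1 + k := by
      have := Real.log_le_sub_one_of_pos (by linarith : 0 < 2 + k)
      linarith
    have h4 : log 4 = 2 * log 2 := by
      rw [show (4 : ℝ) = 2 ^ 2 by norm_num, log_pow]; norm_num
    have h5 : k * log 2 ≤ k * 1 := by gcongr; linarith
    have h6 : (m : ℝ) * log 4 ≤ m * 2 := by gcongr; linarith
    rw [hD]
    linarith
  have hσ1 : rexp (-D) ≤ 1 := Real.exp_le_one_iff.mpr (by linarith)
  have hl0 : 0 ≤ log (4 * D) := log_nonneg (by linarith)
  have key := hmain (η * ((4 * D) ^ (1 / 4 : ℝ) * log (4 * D) ^ θ)) E (rexp (-D)) F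
    (by positivity) hE (exp_pos _) hσ1 hF (hEb _ D (exp_pos _) rfl (by linarith))
  have hσB : rexp (-D) ^ (1 / 2 : ℝ) = B⁻¹ := by
    rw [← Real.exp_mul, show -D * (1 / 2) = -log B by rw [hD]; ring, Real.exp_neg,
      Real.exp_log (by linarith)]
  have hrest : rexp (-D) ^ (1 / 2 : ℝ) * 2 ^ F.card * (E + (2 + Γ) ^ 2) ≤ E + 1 := by
    rw [hσB, mul_assoc, inv_mul_le_iff₀ (by linarith), mul_add, mul_add, mul_one]
    refine add_le_add ?_ le_rfl
    gcongr
    exact le_mul_of_one_le_right (by positivity) (by nlinarith)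
  have hsum : k * (1 / 2) ^ m ≤ ∑ S ∈ F, repWeight S := by
    rw [hk, ← nsmul_eq_mul]
    exact Finset.card_nsmul_le_sum _ _ _ hFm
  have h48 := Real.log_le_log (by linarith) hDle
  have h1 : k * (1 / 2) ^ m ≤ C * (η * ((48 * (k + m)) ^ (1 / 4 : ℝ) *
      log (48 * (k + m)) ^ θ) + (E + 1)) := by
    refine (hsum.trans key).trans ?_
    gcongr
  calc k = 2 ^ m * (k * (1 / 2) ^ m) := by
        rw [mul_left_comm, ← mul_pow]; norm_num
    _ ≤ _ := by gcongr

lemma le_rpow_of_le_mul_rpow {V B s : ℝ} (hV : 0 < V) (hs : s < 1) (h : V ≤ B * V ^ s) :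
    V ≤ B ^ (1 - s)⁻¹ := by
  have h1 : V ^ (1 - s) ≤ B := by
    rw [rpow_sub hV, rpow_one, div_le_iff₀ (by positivity)]
    exact h
  calc V = (V ^ (1 - s)) ^ (1 - s)⁻¹ := by
        rw [← rpow_mul hV.le, mul_inv_cancel₀ (by linarith), rpow_one]
    _ ≤ _ := rpow_le_rpow (by positivity) h1 (inv_nonneg.mpr (by linarith))

lemma log_rpow_le {V θ : ℝ} (hV : 1 ≤ V) (hθ : 0 < θ) :
    log V ^ θ ≤ (4 * θ) ^ θ * V ^ (1 / 4 : ℝ) := by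
  have h1 := Real.log_le_rpow_div (by linarith : 0 ≤ V) (ε := 1 / (4 * θ)) (by positivity)
  calc log V ^ θ ≤ (V ^ (1 / (4 * θ)) / (1 / (4 * θ))) ^ θ :=
        rpow_le_rpow (log_nonneg hV) h1 hθ.le
    _ = _ := by
        rw [div_div_eq_mul_div, div_one, mul_rpow (by positivity) (by positivity),
          ← rpow_mul (by linarith), mul_comm]
        congr 2
        field_simp

lemma exists_le_of_le_mul_log {C θ : ℝ} (hC : 0 < C) (hθ : 0 < θ) :
    ∃ C' : ℝ, 0 < C' ∧ ∀ η E : ℝ, 0 < η → η ≤ 1 → 0 ≤ E → ∀ (m : ℕ) (k : ℝ), 1 ≤ m → 0 ≤ k →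
      k ≤ 2 ^ m * (C * (η * ((48 * (k + m)) ^ (1 / 4 : ℝ) * log (48 * (k + m)) ^ θ) + E)) →
      k ≤ C' * η ^ (4 / 3 : ℝ) * ((2 ^ m : ℝ) ^ (4 / 3 : ℝ) * (m : ℝ) ^ (4 / 3 * θ))
        + (2 * C * E + 1) * (2 ^ m * m) := by
  set c₁ : ℝ := 192 * C * (4 * θ) ^ θ with hc₁
  have hc₁0 : 0 < c₁ := by positivity
  set c₂ : ℝ := 2 * |log c₁| + 2 with hc₂
  have hc₂0 : 0 < c₂ := by positivity
  refine ⟨(192 * C * c₂ ^ θ) ^ (4 / 3 : ℝ), by positivity, ?_⟩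
  intro η E hη hη1 hE m k hm hk h
  have hm1 : (1 : ℝ) ≤ m := by exact_mod_cast hm
  have hX : (1 : ℝ) ≤ 2 ^ m := one_le_pow₀ (by norm_num)
  have hCE : 0 ≤ C * E := by positivity
  have hfirst : 0 ≤ (192 * C * c₂ ^ θ) ^ (4 / 3 : ℝ) * η ^ (4 / 3 : ℝ) *
      ((2 ^ m : ℝ) ^ (4 / 3 : ℝ) * (m : ℝ) ^ (4 / 3 * θ)) := by positivity
  have hsecond : 0 ≤ (2 * C * E + 1) * ((2 : ℝ) ^ m * m) := by positivity
  set X : ℝ := 2 ^ m with hXdef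
  have hXm : X ≤ X * m := le_mul_of_one_le_right (by linarith) hm1
  rcases le_total k m with hkm | hkm
  · refine le_trans ?_ (le_add_of_nonneg_left hfirst)
    have h1 : (m : ℝ) ≤ X * m := le_mul_of_one_le_left (by linarith) hX
    have h2 : 0 ≤ 2 * C * E * (X * m) := by positivity
    linarith
  rcases le_total (k / 2) (X * (C * E)) with hkE | hkE
  · refine le_trans ?_ (le_add_of_nonneg_left hfirst)
    have h1 : C * E * X ≤ C * E * (X * m) := by gcongr
    have h2 : 0 ≤ X * m := by positivity
    linarith
  refine le_trans ?_ (le_add_of_nonneg_right hsecond)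
  set V : ℝ := 96 * k with hV
  have hV1 : 1 ≤ V := by linarith
  have hV0 : 0 < V := by linarith
  have hWV : 48 * (k + m) ≤ V := by linarith
  have hlW : 0 ≤ log (48 * (k + m)) := log_nonneg (by linarith)
  have hlWV := Real.log_le_log (by linarith) hWV
  have hlV : 0 ≤ log V := log_nonneg hV1
  have h1 : V ≤ 192 * C * X * η * V ^ (1 / 4 : ℝ) * log V ^ θ := by
    have h2 : X * (C * (η * ((48 * (k + m)) ^ (1 / 4 : ℝ) * log (48 * (k + m)) ^ θ))) ≤
        X * (C * (η * (V ^ (1 / 4 : ℝ) * log V ^ θ))) := by gcongr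
    linarith
  have hX0 : 0 < X := by linarith
  have hlog : log V ≤ c₂ * m := by
    have h2 : V ≤ (c₁ * X) * V ^ (1 / 2 : ℝ) := by
      refine h1.trans ?_
      calc 192 * C * X * η * V ^ (1 / 4 : ℝ) * log V ^ θ
          ≤ 192 * C * X * 1 * V ^ (1 / 4 : ℝ) * ((4 * θ) ^ θ * V ^ (1 / 4 : ℝ)) := by
            gcongr
            exact log_rpow_le hV1 hθ
        _ = (c₁ * X) * (V ^ (1 / 4 : ℝ) * V ^ (1 / 4 : ℝ)) := by rw [hc₁]; ring
        _ = _ := by rw [← rpow_add hV0]; norm_num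
    have h3 := le_rpow_of_le_mul_rpow hV0 (by norm_num) h2
    have h4 := Real.log_le_log hV0 h3
    rw [log_rpow (by positivity), log_mul hc₁0.ne' hX0.ne', hXdef, log_pow] at h4
    have h5 : (m : ℝ) * log 2 ≤ m * 1 := by
      gcongr
      linarith [Real.log_two_lt_d9]
    have h6 := le_abs_self (log c₁)
    have h7 : |log c₁| * 1 ≤ |log c₁| * m := by gcongr
    norm_num at h4
    rw [hc₂]
    linarith
  have h2 : V ≤ (192 * C * c₂ ^ θ * η * X * (m : ℝ) ^ θ) * V ^ (1 / 4 : ℝ) := by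
    refine h1.trans ?_
    calc 192 * C * X * η * V ^ (1 / 4 : ℝ) * log V ^ θ
        ≤ 192 * C * X * η * V ^ (1 / 4 : ℝ) * (c₂ * m) ^ θ := by gcongr
      _ = _ := by rw [mul_rpow hc₂0.le (by linarith)]; ring
  have h3 := le_rpow_of_le_mul_rpow hV0 (by norm_num) h2
  rw [show (1 - 1 / 4 : ℝ)⁻¹ = 4 / 3 by norm_num, mul_rpow (by positivity) (by positivity),
    mul_rpow (by positivity) (by positivity), mul_rpow (by positivity) hη.le,
    ← rpow_mul (by linarith : (0 : ℝ) ≤ m), mul_comm θ] at h3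
  calc k ≤ V := by linarith
    _ ≤ _ := h3
    _ = _ := by ring

lemma sum_succ_mul_geometric_le {r : ℝ} (h0 : 0 ≤ r) (h1 : r < 1) (J : ℕ) :
    ∑ j ∈ Finset.range J, ((j : ℝ) + 1) * r ^ j ≤ 1 / (1 - r) ^ 2 := by
  have ha := (hasSum_coe_mul_geometric_of_norm_lt_one (𝕜 := ℝ) (r := r)
    (by rwa [Real.norm_of_nonneg h0])).add (hasSum_geometric_of_lt_one h0 h1)
  have h2 : 1 - r ≠ 0 := by linarith
  calc _ = ∑ j ∈ Finset.range J, ((j : ℝ) * r ^ j + r ^ j) :=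
        Finset.sum_congr rfl fun j _ ↦ by ring
    _ ≤ _ := sum_le_hasSum _ (fun j _ ↦ by positivity) ha
    _ = _ := by field_simp; ring

lemma rpow_le_one_add {u a : ℝ} (hu : 0 ≤ u) (ha : 0 ≤ a) (ha1 : a ≤ 1) : u ^ a ≤ 1 + u := by
  rcases le_total u 1 with h | h
  · linarith [rpow_le_one hu h ha]
  · have := rpow_le_rpow_of_exponent_le h ha1
    rw [rpow_one] at this
    linarith

lemma half_rpow_le {δ : ℝ} (h0 : 0 ≤ δ) (h1 : δ ≤ 1) : (1 / 2 : ℝ) ^ δ ≤ 1 - δ / 2 := by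
  have := rpow_one_add_le_one_add_mul_self (s := -1 / 2) (by norm_num) h0 h1
  norm_num at this ⊢
  linarith

lemma sum_geometric_mul_rpow_le {a δ : ℝ} (ha : 0 ≤ a) (ha1 : a ≤ 1) (hδ : 0 < δ) (hδ1 : δ ≤ 1)
    (J : ℕ) : ∑ j ∈ Finset.range J, ((1 / 2 : ℝ) ^ j) ^ (4 / 3 * (1 + δ)) *
      ((2 ^ (j + 1) : ℝ) ^ (4 / 3 : ℝ) * ((j + 1 : ℕ) : ℝ) ^ a) ≤ 24 * (1 / δ) ^ (1 + a) := by
  have hr0 : 0 ≤ 1 - δ / 2 := by linarith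
  have hr1 : 1 - δ / 2 < 1 := by linarith
  have hterm : ∀ j : ℕ, ((1 / 2 : ℝ) ^ j) ^ (4 / 3 * (1 + δ)) *
      ((2 ^ (j + 1) : ℝ) ^ (4 / 3 : ℝ) * ((j + 1 : ℕ) : ℝ) ^ a) ≤
      4 * (1 / δ) ^ a * ((1 - δ / 2) ^ j + δ * (((j : ℝ) + 1) * (1 - δ / 2) ^ j)) := by
    intro j
    have h1 : ((1 / 2 : ℝ) ^ j) ^ (4 / 3 * (1 + δ)) * (2 ^ (j + 1) : ℝ) ^ (4 / 3 : ℝ) ≤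
        4 * (1 - δ / 2) ^ j := by
      have e1 : (2 : ℝ) ^ (4 / 3 : ℝ) ≤ 4 := by
        calc (2 : ℝ) ^ (4 / 3 : ℝ) ≤ 2 ^ (2 : ℝ) :=
              rpow_le_rpow_of_exponent_le (by norm_num) (by norm_num)
          _ = 4 := by norm_num
      have e2 : ((1 / 2 : ℝ) ^ j) ^ (4 / 3 * δ) ≤ (1 - δ / 2) ^ j := by
        calc ((1 / 2 : ℝ) ^ j) ^ (4 / 3 * δ) ≤ ((1 / 2 : ℝ) ^ j) ^ δ :=
              rpow_le_rpow_of_exponent_ge (by positivity)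
                (pow_le_one₀ (by norm_num) (by norm_num)) (by linarith)
          _ = ((1 / 2 : ℝ) ^ δ) ^ j := (rpow_pow_comm (by norm_num) _ _).symm
          _ ≤ _ := by
            gcongr
            exact half_rpow_le hδ.le hδ1
      have e3 : ((1 / 2 : ℝ) ^ j) ^ (4 / 3 : ℝ) * (2 ^ (j + 1) : ℝ) ^ (4 / 3 : ℝ) =
          (2 : ℝ) ^ (4 / 3 : ℝ) := by
        rw [← mul_rpow (by positivity) (by positivity), pow_succ, ← mul_assoc, ← mul_pow]
        norm_num
      calc _ = (((1 / 2 : ℝ) ^ j) ^ (4 / 3 : ℝ) * (2 ^ (j + 1) : ℝ) ^ (4 / 3 : ℝ)) *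
            ((1 / 2 : ℝ) ^ j) ^ (4 / 3 * δ) := by
            rw [mul_add, mul_one, rpow_add (by positivity)]; ring
        _ ≤ 4 * (1 - δ / 2) ^ j := by rw [e3]; gcongr
    have h2 : ((j + 1 : ℕ) : ℝ) ^ a ≤ (1 / δ) ^ a * (1 + δ * ((j : ℝ) + 1)) := by
      have := rpow_le_one_add (u := δ * ((j : ℝ) + 1)) (by positivity) ha ha1
      calc ((j + 1 : ℕ) : ℝ) ^ a = (1 / δ) ^ a * (δ * ((j : ℝ) + 1)) ^ a := by
            rw [← mul_rpow (by positivity) (by positivity)]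
            congr 1
            push_cast
            field_simp
        _ ≤ _ := by gcongr
    calc _ = (((1 / 2 : ℝ) ^ j) ^ (4 / 3 * (1 + δ)) * (2 ^ (j + 1) : ℝ) ^ (4 / 3 : ℝ)) *
          ((j + 1 : ℕ) : ℝ) ^ a := by ring
      _ ≤ (4 * (1 - δ / 2) ^ j) * ((1 / δ) ^ a * (1 + δ * ((j : ℝ) + 1))) := by gcongr
      _ = _ := by ring
  refine (Finset.sum_le_sum fun j _ ↦ hterm j).trans ?_
  rw [← Finset.mul_sum, Finset.sum_add_distrib, ← Finset.mul_sum]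
  have h1 := sum_le_hasSum (Finset.range J) (fun j _ ↦ by positivity)
    (hasSum_geometric_of_lt_one hr0 hr1)
  have h2 := sum_succ_mul_geometric_le hr0 hr1 J
  calc _ ≤ 4 * (1 / δ) ^ a * ((1 - (1 - δ / 2))⁻¹ + δ * (1 / (1 - (1 - δ / 2)) ^ 2)) := by gcongr
    _ = 24 * (1 / δ) ^ (1 + a) := by
      rw [rpow_add (by positivity), rpow_one, sub_sub_cancel]
      field_simp
      norm_num

lemma exists_sum_geometric_mul_le : ∃ C : ℝ, 0 < C ∧ ∀ (δ : ℝ) (J : ℕ), 0 < δ →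
    ∑ j ∈ Finset.range J, ((1 / 2 : ℝ) ^ j) ^ (4 / 3 * (1 + δ)) *
      (2 ^ (j + 1) * ((j + 1 : ℕ) : ℝ)) ≤ C := by
  set r : ℝ := (1 / 2) ^ (1 / 3 : ℝ) with hr
  have hr0 : 0 ≤ r := by positivity
  have hr1 : r < 1 := rpow_lt_one (by norm_num) (by norm_num) (by norm_num)
  have hr2 : 0 < 1 - r := by linarith
  refine ⟨2 * (1 / (1 - r) ^ 2), by positivity, fun δ J hδ ↦ ?_⟩
  refine le_trans (Finset.sum_le_sum (g := fun j : ℕ ↦ 2 * (((j : ℝ) + 1) * r ^ j))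
    fun j _ ↦ ?_) ?_
  · calc _ ≤ ((1 / 2 : ℝ) ^ j) ^ (4 / 3 : ℝ) * (2 ^ (j + 1) * ((j + 1 : ℕ) : ℝ)) := by
          refine mul_le_mul_of_nonneg_right ?_ (by positivity)
          exact rpow_le_rpow_of_exponent_ge (by positivity)
            (pow_le_one₀ (by norm_num) (by norm_num)) (by linarith)
      _ = (1 / 2 * 2) ^ j * (2 * (((j : ℝ) + 1) * r ^ j)) := by
          rw [hr, rpow_pow_comm (by norm_num), show (4 / 3 : ℝ) = 1 / 3 + 1 by norm_num,
            rpow_add (by positivity), rpow_one, mul_pow]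
          push_cast
          ring
      _ = _ := by norm_num
  · rw [← Finset.mul_sum]
    gcongr
    exact sum_succ_mul_geometric_le hr0 hr1 J

lemma exists_dyadic {S : Finset ℕ} (hS : ∀ p ∈ S, p.Prime ∧ p % 4 = 1) :
    ∃ j : ℕ, (1 / 2 : ℝ) ^ (j + 1) ≤ repWeight S ∧ repWeight S ≤ (1 / 2) ^ j := by
  have h1 : repWeight S ≤ 1 := (repWeight_le hS).trans
    (rpow_le_one_of_one_le_of_nonpos (one_le_prod_primes hS) (by norm_num))
  obtain ⟨j, hj, hj'⟩ := exists_nat_pow_near_of_lt_one (repWeight_pos hS) h1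
    (by norm_num : (0 : ℝ) < 1 / 2) (by norm_num)
  exact ⟨j, hj.le, hj'⟩

lemma exists_sum_repWeight_rpow_le {a : ℝ} (ha : 0 < a) (ha1 : a ≤ 1)
    (hP : ∀ η : ℝ, 0 < η → ∃ t₀ : ℝ, ∀ t ≥ t₀, |latticeP (t ^ 2)| ≤
      η * (t ^ (1 / 2 : ℝ) * (2 * log t) ^ (1 / 4 : ℝ) * log (2 * log t) ^ (3 / 4 * a))) :
    ∃ C : ℝ, 0 < C ∧ ∀ η : ℝ, 0 < η → η ≤ 1 → ∃ E : ℝ, ∀ (δ : ℝ) (Q : Finset ℕ),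
      0 < δ → δ ≤ 1 → (∀ p ∈ Q, p.Prime ∧ p % 4 = 1) →
      ∑ S ∈ Q.powerset, repWeight S ^ (4 / 3 * (1 + δ)) ≤
        C * η ^ (4 / 3 : ℝ) * (1 / δ) ^ (1 + a) + E := by
  have hθ : 0 < 3 / 4 * a := by positivity
  obtain ⟨C₁, hC₁, hcard⟩ := exists_card_le hθ.le hP
  obtain ⟨C₂, hC₂, hbound⟩ := exists_le_of_le_mul_log hC₁ hθ
  obtain ⟨C₃, hC₃, hgeom⟩ := exists_sum_geometric_mul_le
  rw [show 4 / 3 * (3 / 4 * a) = a by ring] at hbound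
  refine ⟨C₂ * 24, by positivity, fun η hη hη1 ↦ ?_⟩
  obtain ⟨E, hE, hEcard⟩ := hcard η hη
  refine ⟨(2 * C₁ * E + 1) * C₃, fun δ Q hδ hδ1 hQ ↦ ?_⟩
  have hex : ∀ S : Finset ℕ, ∃ j : ℕ, S ∈ Q.powerset →
      (1 / 2 : ℝ) ^ (j + 1) ≤ repWeight S ∧ repWeight S ≤ (1 / 2) ^ j := by
    intro S
    by_cases h : S ∈ Q.powerset
    · obtain ⟨j, hj⟩ := exists_dyadic fun p hp ↦ hQ p (Finset.mem_powerset.mp h hp)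
      exact ⟨j, fun _ ↦ hj⟩
    · exact ⟨0, fun h' ↦ absurd h' h⟩
  choose lev hlev using hex
  set J := Q.powerset.sup lev + 1 with hJ
  have hmaps : ∀ S ∈ Q.powerset, lev S ∈ Finset.range J := fun S hS ↦
    Finset.mem_range.mpr (Nat.lt_succ_of_le (Finset.le_sup (f := lev) hS))
  rw [← Finset.sum_fiberwise_of_maps_to hmaps]
  have hfib : ∀ j ∈ Finset.range J,
      ∑ S ∈ Q.powerset with lev S = j, repWeight S ^ (4 / 3 * (1 + δ)) ≤
      C₂ * η ^ (4 / 3 : ℝ) * (((1 / 2 : ℝ) ^ j) ^ (4 / 3 * (1 + δ)) *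
        ((2 ^ (j + 1) : ℝ) ^ (4 / 3 : ℝ) * ((j + 1 : ℕ) : ℝ) ^ a)) +
      (2 * C₁ * E + 1) * (((1 / 2 : ℝ) ^ j) ^ (4 / 3 * (1 + δ)) *
        (2 ^ (j + 1) * ((j + 1 : ℕ) : ℝ))) := by
    intro j _
    set F := Q.powerset.filter fun S ↦ lev S = j with hF
    have hFQ : ∀ S ∈ F, S ∈ Q.powerset ∧ lev S = j := fun S hS ↦ Finset.mem_filter.mp hS
    have hFp : ∀ S ∈ F, ∀ p ∈ S, p.Prime ∧ p % 4 = 1 := fun S hS p hp ↦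
      hQ p (Finset.mem_powerset.mp (hFQ S hS).1 hp)
    have h1 := hEcard (j + 1) F (by omega) hFp fun S hS ↦ by
      obtain ⟨h, rfl⟩ := hFQ S hS
      exact (hlev S h).1
    have h2 := hbound η E hη hη1 hE (j + 1) F.card (by omega) (Nat.cast_nonneg _) h1
    calc ∑ S ∈ F, repWeight S ^ (4 / 3 * (1 + δ))
        ≤ F.card • ((1 / 2 : ℝ) ^ j) ^ (4 / 3 * (1 + δ)) := by
          refine Finset.sum_le_card_nsmul _ _ _ fun S hS ↦ ?_
          refine rpow_le_rpow (repWeight_pos (hFp S hS)).le ?_ (by positivity)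
          obtain ⟨h, rfl⟩ := hFQ S hS
          exact (hlev S h).2
      _ = ((1 / 2 : ℝ) ^ j) ^ (4 / 3 * (1 + δ)) * F.card := by rw [nsmul_eq_mul, mul_comm]
      _ ≤ _ := mul_le_mul_of_nonneg_left h2 (by positivity)
      _ = _ := by ring
  refine (Finset.sum_le_sum hfib).trans ?_
  rw [Finset.sum_add_distrib, ← Finset.mul_sum, ← Finset.mul_sum]
  have h1 := sum_geometric_mul_rpow_le ha.le ha1 hδ hδ1 J
  have h2 := hgeom δ J hδ
  calc _ ≤ C₂ * η ^ (4 / 3 : ℝ) * (24 * (1 / δ) ^ (1 + a)) + (2 * C₁ * E + 1) * C₃ := by gcongr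
    _ = _ := by ring

lemma not_forall_abs_latticeP_le :
    ¬ ∀ η : ℝ, 0 < η → ∃ t₀ : ℝ, ∀ t ≥ t₀, |latticeP (t ^ 2)| ≤
      η * (t ^ (1 / 2 : ℝ) * (2 * log t) ^ (1 / 4 : ℝ) *
        log (2 * log t) ^ (3 / 4 * ((2 : ℝ) ^ (1 / 3 : ℝ) - 1))) := by
  intro hP
  set a : ℝ := (2 : ℝ) ^ (1 / 3 : ℝ) - 1 with ha
  have ha0 : 0 < a := sub_pos.mpr (one_lt_rpow (by norm_num) (by norm_num))
  have ha1 : a ≤ 1 := by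
    have : (2 : ℝ) ^ (1 / 3 : ℝ) ≤ 2 ^ (1 : ℝ) :=
      rpow_le_rpow_of_exponent_le (by norm_num) (by norm_num)
    rw [rpow_one] at this
    linarith
  obtain ⟨C, hC, hupper⟩ := exists_sum_repWeight_rpow_le ha0 ha1 hP
  obtain ⟨c, hc, hlower⟩ := exists_sum_repWeight_rpow_ge
  set η : ℝ := min 1 ((c / (2 * C)) ^ (3 / 4 : ℝ)) with hη
  have hη0 : 0 < η := lt_min one_pos (by positivity)
  have hηC : C * η ^ (4 / 3 : ℝ) ≤ c / 2 := by
    have h1 : η ^ (4 / 3 : ℝ) ≤ ((c / (2 * C)) ^ (3 / 4 : ℝ)) ^ (4 / 3 : ℝ) :=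
      rpow_le_rpow hη0.le (min_le_right _ _) (by norm_num)
    rw [← rpow_mul (by positivity)] at h1
    norm_num at h1
    calc C * η ^ (4 / 3 : ℝ) ≤ C * (c / (2 * C)) := by gcongr
      _ = c / 2 := by field_simp
  obtain ⟨E, hE⟩ := hupper η hη0 (min_le_left _ _)
  have hkey : ∀ x : ℝ, 1 ≤ x → c / 2 * x ^ (1 + a) ≤ E := by
    intro x hx
    have hx0 : 0 < x := by linarith
    have hδ1 : 1 / x ≤ 1 := (div_le_one hx0).mpr hx
    obtain ⟨Q, hQ, hsum⟩ := hlower (1 / x) (by positivity) hδ1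
    have h2 := hE (1 / x) Q (by positivity) hδ1 hQ
    rw [one_div_one_div] at hsum h2
    rw [show (2 : ℝ) ^ (1 / 3 : ℝ) = 1 + a by rw [ha]; ring] at hsum
    have h3 : C * η ^ (4 / 3 : ℝ) * x ^ (1 + a) ≤ c / 2 * x ^ (1 + a) := by gcongr
    linarith
  have hlim : Tendsto (fun x : ℝ ↦ c / 2 * x ^ (1 + a)) atTop atTop :=
    (tendsto_rpow_atTop (by linarith)).const_mul_atTop (by positivity)
  obtain ⟨x, hx, hx1⟩ := ((hlim.eventually_gt_atTop E).and (eventually_ge_atTop 1)).exists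
  exact absurd (hkey x hx1) (not_le.mpr hx)

end

theorem soundararajan_omega_circle :
    ∃ c : ℝ, 0 < c ∧ ∃ᶠ x : ℝ in atTop,
      c * (x ^ ((1 : ℝ) / 4) * Real.log x ^ ((1 : ℝ) / 4) *
        Real.log (Real.log x) ^ (((3 : ℝ) / 4) * ((2 : ℝ) ^ ((1 : ℝ) / 3) - 1)) *
        Real.log (Real.log (Real.log x)) ^ (-(5 : ℝ) / 8)) ≤ |latticeP x| := by
  by_contra! hcon
  have hcon1 := hcon 1 one_pos
  apply not_forall_abs_latticeP_le
  intro η hη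
  have hsmall : Tendsto (fun x : ℝ ↦ log (log (log x)) ^ (-(5 : ℝ) / 8)) atTop (nhds 0) := by
    have h := (tendsto_rpow_neg_atTop (y := 5 / 8) (by norm_num)).comp
      (tendsto_log_atTop.comp (tendsto_log_atTop.comp tendsto_log_atTop))
    rw [neg_div]
    exact h
  have hev : ∀ᶠ x : ℝ in atTop, |latticeP x| ≤ η * (x ^ ((1 : ℝ) / 4) * log x ^ ((1 : ℝ) / 4) *
      log (log x) ^ (((3 : ℝ) / 4) * ((2 : ℝ) ^ ((1 : ℝ) / 3) - 1))) := by
    filter_upwards [hcon1, hsmall.eventually_le_const hη,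
      eventually_ge_atTop (rexp 1)] with x h1 h2 h3
    have hx0 : 0 < x := (exp_pos 1).trans_le h3
    have hlog : 1 ≤ log x := (Real.le_log_iff_exp_le hx0).mpr h3
    have hlog2 : 0 ≤ log (log x) := log_nonneg hlog
    rw [one_mul] at h1
    refine h1.le.trans ?_
    rw [mul_comm η]
    gcongr
  obtain ⟨t₀, ht₀⟩ := eventually_atTop.mp
    (((tendsto_pow_atTop two_ne_zero).eventually hev).and (eventually_gt_atTop (0 : ℝ)))
  refine ⟨t₀, fun t ht ↦ ?_⟩
  obtain ⟨h1, h2⟩ := ht₀ t ht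
  have h3 : (t ^ 2) ^ ((1 : ℝ) / 4) = t ^ (1 / 2 : ℝ) := by
    rw [← rpow_natCast, ← rpow_mul h2.le]
    norm_num
  rw [h3, log_pow] at h1
  exact_mod_cast h1
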